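/- arXiv:2508.06161 — 2 statements merged into one kernel-verified Lean document; each statement's English description precedes it below -/
import Mathlib

section
/- Let E be an H-field with derivation ∂, and let H be a subfield of E with ∂(H) ⊆ H such that H, with the induced ordering and derivation, is itself an H-field and is short. Assume E is differentially algebraic over H, i.e., for every e ∈ E the family (e, ∂e, ∂²e, …) is algebraically dependent over H, and assume the constant field C_E = {x ∈ E : ∂x = 0} of E is short. Then E is short (as a linearly ordered set). -/
/-- A (pre)ordered set is *short* if every subset of it has countable cofinality and countable
coinitiality, i.e. admits a countable cofinal subset and a countable coinitial subset. -/
def IsShort (α : Type*) [Preorder α] : Prop :=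
  ∀ A : Set α,
    (∃ B ⊆ A, B.Countable ∧ ∀ x ∈ A, ∃ y ∈ B, x ≤ y) ∧
    (∃ B ⊆ A, B.Countable ∧ ∀ x ∈ A, ∃ y ∈ B, y ≤ x)

/-- `H` together with the linear order and the map `d` is an *H-field*:  `H` is a linearly
ordered field (the order is compatible with the field operations), `d` is a derivation on `H`,
and, writing `C = {h | d h = 0}` for the constant field, `𝒪 = {h | |h| ≤ c for some c ∈ C}` and
`𝔬 = {h | |h| < c for all 0 < c ∈ C}`, we have (H1) `d h > 0` whenever `h > C`, and
(H2) `𝒪 = C + 𝔬`. -/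
structure IsHField (H : Type*) [Field H] [LinearOrder H] (d : H → H) : Prop where
  add_le_add_left : ∀ a b : H, a ≤ b → ∀ c : H, c + a ≤ c + b
  mul_pos : ∀ a b : H, 0 < a → 0 < b → 0 < a * b
  map_add : ∀ x y, d (x + y) = d x + d y
  leibniz : ∀ x y, d (x * y) = x * d y + y * d x
  h1 : ∀ h : H, (∀ c : H, d c = 0 → c < h) → 0 < d h
  h2 : ∀ x : H, (∃ c, d c = 0 ∧ |x| ≤ c) ↔
    ∃ c e : H, d c = 0 ∧ (∀ c' : H, d c' = 0 → 0 < c' → |e| < c') ∧ x = c + e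


universe u

/-- A linear order in which every countable subset has a strict upper bound. -/
def IsLong (I : Type*) [LinearOrder I] : Prop :=
  ∀ B : Set I, B.Countable → ∃ i, ∀ b ∈ B, b < i

namespace IsLong

variable {I : Type*} [LinearOrder I]

theorem exists_gt (hI : IsLong I) (i : I) : ∃ j, i < j := by
  obtain ⟨j, hj⟩ := hI {i} (Set.countable_singleton i)
  exact ⟨j, hj i rfl⟩

theorem exists_forall_gt {κ : Type*} [Countable κ] (hI : IsLong I) (f : κ → I) :
    ∃ i, ∀ k, f k < i := by
  obtain ⟨i, hi⟩ := hI (Set.range f) (Set.countable_range f)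
  exact ⟨i, fun k => hi _ ⟨k, rfl⟩⟩

theorem subtype (hI : IsLong I) {T : Set I} (hT : IsCofinal T) : IsLong T := by
  intro B hB
  obtain ⟨i, hi⟩ := hI (Subtype.val '' B) (hB.image _)
  obtain ⟨t, ht, hit⟩ := hT i
  exact ⟨⟨t, ht⟩, fun b hb => (hi b ⟨b, hb, rfl⟩).trans_le hit⟩

theorem exists_isCofinal_fiber {κ : Type*} [Countable κ] (hI : IsLong I) (f : I → κ) :
    ∃ k, IsCofinal {i | f i = k} := by
  by_contra! h
  simp only [IsCofinal, Set.mem_ofPred_eq] at h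
  push Not at h
  choose g hg using h
  obtain ⟨i, hi⟩ := hI.exists_forall_gt g
  exact (hg (f i) i rfl).not_gt (hi _)

end IsLong

section Monotone

variable {I α : Type*} [LinearOrder I] [LinearOrder α]

theorem IsShort.eventually_const_of_monotone (hα : IsShort α) (hI : IsLong I) {f : I → α}
    (hf : Monotone f) : ∃ i, ∀ j, i ≤ j → f j = f i := by
  obtain ⟨B, hBA, hB, hcof⟩ := (hα (Set.range f)).1
  have : Countable B := hB
  choose g hg using fun b : B => hBA b.2
  obtain ⟨i, hi⟩ := hI.exists_forall_gt g
  refine ⟨i, fun j hij => le_antisymm ?_ (hf hij)⟩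
  obtain ⟨b, hb, hjb⟩ := hcof (f j) ⟨j, rfl⟩
  exact hjb.trans ((hg ⟨b, hb⟩).symm.le.trans (hf (hi ⟨b, hb⟩).le))

theorem IsShort.not_strictMono (hα : IsShort α) (hI : IsLong I) (f : I → α) :
    ¬ StrictMono f := by
  intro hf
  obtain ⟨i, hi⟩ := hα.eventually_const_of_monotone hI hf.monotone
  obtain ⟨j, hj⟩ := hI.exists_gt i
  exact (hf hj).ne' (hi j hj.le)

theorem Monotone.exists_isCofinal_strictMono {f : I → α} (hf : Monotone f)
    (h : ∀ i, ∃ j, i ≤ j ∧ f j ≠ f i) :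
    ∃ T : Set I, IsCofinal T ∧ StrictMono fun t : T => f t := by
  choose g hg using fun x : Set.range f => x.2
  refine ⟨Set.range g, fun i => ?_, ?_⟩
  · obtain ⟨j, hij, hne⟩ := h i
    refine ⟨g ⟨f j, j, rfl⟩, ⟨_, rfl⟩, le_of_not_gt fun hlt => ?_⟩
    have h1 := hf hlt.le
    rw [hg] at h1
    exact hne (le_antisymm h1 (hf hij))
  · rintro ⟨_, x, rfl⟩ ⟨_, y, rfl⟩ hxy
    refine lt_of_le_of_ne (hf (le_of_lt hxy)) fun heq => ?_
    simp only [hg] at heq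
    rw [Subtype.ext heq] at hxy
    exact lt_irrefl _ hxy

theorem Antitone.exists_isCofinal_strictAnti {f : I → α} (hf : Antitone f)
    (h : ∀ i, ∃ j, i ≤ j ∧ f j ≠ f i) :
    ∃ T : Set I, IsCofinal T ∧ StrictAnti fun t : T => f t :=
  Monotone.exists_isCofinal_strictMono (α := αᵒᵈ) (f := OrderDual.toDual ∘ f) hf h

end Monotone

theorem exists_isLong_strictMono_of_not_isShort {E : Type u} [AddCommGroup E] [LinearOrder E]
    [IsOrderedAddMonoid E] (h : ¬ IsShort E) :
    ∃ (I : Type u) (_ : LinearOrder I) (f : I → E), IsLong I ∧ StrictMono f := by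
  have key : ∀ A : Set E, (¬ ∃ B ⊆ A, B.Countable ∧ ∀ x ∈ A, ∃ y ∈ B, x ≤ y) →
      ∃ (I : Type u) (_ : LinearOrder I) (f : I → E), IsLong I ∧ StrictMono f := by
    intro A hA
    refine ⟨A, inferInstance, Subtype.val, fun B hB => ?_, fun _ _ h => h⟩
    push Not at hA
    obtain ⟨x, hx, hlt⟩ := hA (Subtype.val '' B) (by rintro _ ⟨b, _, rfl⟩; exact b.2)
      (hB.image _)
    exact ⟨⟨x, hx⟩, fun b hb => hlt b ⟨b, hb, rfl⟩⟩
  unfold IsShort at h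
  push Not at h
  obtain ⟨A, hA⟩ := h
  by_cases h1 : ∃ B ⊆ A, B.Countable ∧ ∀ x ∈ A, ∃ y ∈ B, x ≤ y
  · refine key (-A) ?_
    rintro ⟨B, hBA, hB, hcof⟩
    obtain ⟨B', hB', hc, hx⟩ : ∃ B' ⊆ A, B'.Countable ∧ ∀ x ∈ A, ∃ y ∈ B', y ≤ x := by
      refine ⟨Neg.neg '' B, ?_, hB.image _, fun x hx => ?_⟩
      · rintro _ ⟨b, hb, rfl⟩
        exact hBA hb
      · obtain ⟨y, hy, hxy⟩ := hcof (-x) (by simpa using hx)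
        exact ⟨-y, ⟨y, hy, rfl⟩, neg_le.mp hxy⟩
    obtain ⟨x, hxA, hlt⟩ := hA h1 B' hB' hc
    obtain ⟨y, hy, hyx⟩ := hx x hxA
    exact (hlt y hy).not_ge hyx
  · exact key A h1

section HField

variable {E : Type u} [Field E] {D : Derivation ℤ E E}

/-- The logarithmic derivative `x' / x`. -/
def logDer (D : Derivation ℤ E E) (x : E) : E := D x / x

theorem logDer_mul {x y : E} (hx : x ≠ 0) (hy : y ≠ 0) :
    logDer D (x * y) = logDer D x + logDer D y := by
  simp only [logDer, D.leibniz, smul_eq_mul]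
  field_simp
  ring

theorem logDer_one : logDer D 1 = 0 := by simp [logDer]

theorem logDer_neg (x : E) : logDer D (-x) = logDer D x := by simp [logDer]

theorem logDer_inv {x : E} (hx : x ≠ 0) : logDer D x⁻¹ = -logDer D x := by
  have := logDer_mul (D := D) hx (inv_ne_zero hx)
  rw [mul_inv_cancel₀ hx, logDer_one] at this
  linear_combination -this

theorem logDer_of_eq_or_eq_inv {x y : E} (hx : x ≠ 0) (h : y = x ∨ y = x⁻¹) :
    logDer D y = logDer D x ∨ logDer D y = -logDer D x := by
  rcases h with rfl | rfl
  · exact Or.inl rfl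
  · exact Or.inr (logDer_inv hx)

theorem logDer_div {x y : E} (hx : x ≠ 0) (hy : y ≠ 0) :
    logDer D (x / y) = logDer D x - logDer D y := by
  rw [div_eq_mul_inv, logDer_mul hx (inv_ne_zero hy), logDer_inv hy, sub_eq_add_neg]

theorem logDer_pow {x : E} (hx : x ≠ 0) (n : ℕ) : logDer D (x ^ n) = n * logDer D x := by
  induction n with
  | zero => simp [logDer_one]
  | succ n ih =>
    rw [pow_succ, logDer_mul (pow_ne_zero n hx) hx, ih]
    push_cast
    ring

theorem derivation_mul_eq_zero {a b : E} (ha : D a = 0) (hb : D b = 0) : D (a * b) = 0 := by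
  simp [ha, hb]

theorem derivation_inv_eq_zero {a : E} (ha : D a = 0) : D a⁻¹ = 0 := by
  simp [D.leibniz_inv, ha]

variable [LinearOrder E]

theorem logDer_abs (x : E) : logDer D |x| = logDer D x := by
  rcases abs_choice x with h | h <;> rw [h]
  exact logDer_neg x

theorem derivation_abs_eq_zero {c : E} (hc : D c = 0) : D |c| = 0 := by
  rcases abs_choice c with h | h <;> rw [h]
  · exact hc
  · simp [hc]

/-- `x` is infinitesimal relative to `y`, with respect to the constants of `D`. -/
def Negligible (D : Derivation ℤ E E) (x y : E) : Prop := ∀ c : E, D c = 0 → c * |x| < |y|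

namespace Negligible

theorem irrefl (x : E) : ¬ Negligible D x x := fun h => by
  have := h 1 (by simp)
  rw [one_mul] at this
  exact lt_irrefl _ this

theorem abs_lt {x y : E} (h : Negligible D x y) : |x| < |y| := by
  simpa using h 1 (by simp)

variable [IsStrictOrderedRing E]

theorem ne_zero {x y : E} (h : Negligible D x y) : y ≠ 0 := by
  have := h 0 (map_zero _)
  rw [zero_mul] at this
  exact abs_pos.mp this

theorem of_abs_le {x y z k : E} (h : Negligible D x z) (hk : D k = 0) (hy : |y| ≤ k * |x|) :
    Negligible D y z := by
  intro c hc
  have h1 : c * |y| ≤ |c| * (k * |x|) :=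
    (mul_le_mul_of_nonneg_right (le_abs_self c) (abs_nonneg y)).trans
      (mul_le_mul_of_nonneg_left hy (abs_nonneg c))
  refine h1.trans_lt ?_
  rw [← mul_assoc]
  exact h _ (derivation_mul_eq_zero (derivation_abs_eq_zero hc) hk)

theorem neg {x z : E} (h : Negligible D x z) : Negligible D (-x) z :=
  h.of_abs_le (k := 1) (by simp) (by simp)

theorem natCast_mul {x z : E} (h : Negligible D x z) (n : ℕ) : Negligible D (n * x) z :=
  h.of_abs_le (k := n) (by simp) (by simp [abs_mul])

theorem add {x y z : E} (hx : Negligible D x z) (hy : Negligible D y z) :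
    Negligible D (x + y) z := by
  rcases le_total |x| |y| with h | h
  · refine hy.of_abs_le (k := 2) (by simpa using D.map_natCast 2) ?_
    linarith [abs_add_le x y]
  · refine hx.of_abs_le (k := 2) (by simpa using D.map_natCast 2) ?_
    linarith [abs_add_le x y]

theorem sub {x y z : E} (hx : Negligible D x z) (hy : Negligible D y z) :
    Negligible D (x - y) z := by
  rw [sub_eq_add_neg]
  exact hx.add hy.neg

theorem mul_right {x y : E} (h : Negligible D x y) {z : E} (hz : z ≠ 0) :
    Negligible D (x * z) (y * z) := by
  intro c hc
  rw [abs_mul, abs_mul, ← mul_assoc]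
  exact mul_lt_mul_of_pos_right (h c hc) (abs_pos.mpr hz)

end Negligible

namespace IsHField

variable [IsStrictOrderedRing E]

theorem logDer_pos (hE : IsHField E D) {x : E} (hx : Negligible D 1 x) : 0 < logDer D x := by
  have h0 := hx.ne_zero
  rw [← logDer_abs]
  refine div_pos (hE.h1 _ fun c hc => ?_) (abs_pos.mpr h0)
  simpa using hx c hc

/-- Derivatives of infinitesimals are negligible relative to logarithmic derivatives of infinite
elements. -/
theorem negligible_derivation (hE : IsHField E D) {u a : E} (hu : Negligible D u 1)
    (ha : Negligible D 1 a) : Negligible D (D u) (logDer D a) := by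
  have hpos := hE.logDer_pos ha
  have ha0 := ha.ne_zero
  have key : ∀ u : E, Negligible D u 1 → D u < 2 * logDer D a := by
    intro u hu
    have hu1 : |u| < 1 := by simpa using hu.abs_lt
    obtain ⟨h1, h2⟩ := _root_.abs_lt.mp hu1
    have hne : (1 + u) ≠ 0 := by linarith
    have hbig : Negligible D 1 (a / (1 + u)) := by
      intro c hc
      have h3 := ha (|c| * 2) (derivation_mul_eq_zero (derivation_abs_eq_zero hc)
        (by simpa using D.map_natCast 2))
      rw [abs_one, mul_one] at h3 ⊢
      rw [abs_div, abs_of_pos (by linarith : 0 < 1 + u), lt_div_iff₀ (by linarith)]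
      nlinarith [abs_nonneg c, le_abs_self c]
    have h4 := hE.logDer_pos hbig
    rw [logDer_div ha0 hne] at h4
    have h5 : logDer D (1 + u) * (1 + u) = D u := by
      rw [logDer, div_mul_cancel₀ _ hne]
      simp
    nlinarith
  intro c hc
  have hmem : ∀ k : E, D k = 0 → Negligible D (k * u) 1 := fun k hk =>
    hu.of_abs_le (derivation_abs_eq_zero hk) (abs_mul k u).le
  have hc2 : D (c * 2) = 0 := derivation_mul_eq_zero hc (by simpa using D.map_natCast 2)
  have h1 := key _ (hmem (c * 2) hc2)
  have h2 := key _ (hmem (-(c * 2)) (by rw [map_neg, hc2, neg_zero]))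
  rw [D.leibniz, hc2] at h1
  rw [D.leibniz, map_neg, hc2] at h2
  simp only [smul_eq_mul, neg_zero, mul_zero, add_zero] at h1 h2
  rw [abs_of_pos hpos]
  rcases abs_choice (D u) with h | h <;> rw [h] <;> linarith

/-- Elements bounded by a constant and bounded away from zero by a constant are infinitesimally
close to a nonzero constant. -/
theorem negligible_logDer (hE : IsHField E D) {x a k l : E} (hk : D k = 0) (hx : |x| ≤ k)
    (hl : D l = 0) (hx' : |x⁻¹| ≤ l) (ha : Negligible D 1 a) :
    Negligible D (logDer D x) (logDer D a) := by
  obtain ⟨c, e, hc, he, rfl⟩ := (hE.h2 x).mp ⟨k, hk, hx⟩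
  have he1 : Negligible D e 1 := by
    intro b hb
    rw [abs_one]
    rcases le_or_gt b 0 with h | h
    · exact (mul_nonpos_of_nonpos_of_nonneg h (abs_nonneg e)).trans_lt one_pos
    · have := he b⁻¹ (derivation_inv_eq_zero hb) (inv_pos.mpr h)
      have h2 := mul_lt_mul_of_pos_left this h
      rwa [mul_inv_cancel₀ h.ne'] at h2
  refine (hE.negligible_derivation he1 ha).of_abs_le hl ?_
  rw [logDer, D.map_add, hc, zero_add, div_eq_mul_inv, abs_mul, mul_comm]
  exact mul_le_mul_of_nonneg_right hx' (abs_nonneg _)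

end IsHField

end HField

section Val

variable {E : Type u} [Field E] [LinearOrder E] [IsStrictOrderedRing E] {D : Derivation ℤ E E}

namespace IsHField

/-- The convex hull of the constant field, a valuation ring. -/
def valuationSubring (_ : IsHField E D) : ValuationSubring E where
  carrier := {x | ∃ c, D c = 0 ∧ |x| ≤ c}
  mul_mem' := by
    rintro x y ⟨a, ha, hxa⟩ ⟨b, hb, hyb⟩
    refine ⟨a * b, derivation_mul_eq_zero ha hb, ?_⟩
    rw [abs_mul]
    exact mul_le_mul hxa hyb (abs_nonneg y) ((abs_nonneg x).trans hxa)
  one_mem' := ⟨1, by simp⟩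
  add_mem' := by
    rintro x y ⟨a, ha, hxa⟩ ⟨b, hb, hyb⟩
    exact ⟨a + b, by simp [ha, hb], (abs_add_le x y).trans (add_le_add hxa hyb)⟩
  zero_mem' := ⟨0, by simp⟩
  neg_mem' := by
    rintro x ⟨a, ha, hxa⟩
    exact ⟨a, ha, by rwa [abs_neg]⟩
  mem_or_inv_mem' := by
    intro x
    rcases le_total |x| 1 with h | h
    · exact Or.inl ⟨1, by simp, h⟩
    · exact Or.inr ⟨1, by simp, by rw [abs_inv]; exact inv_le_one_of_one_le₀ h⟩

/-- The value group of an H-field, written additively; larger elements have larger values. -/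
abbrev ValGroup (hE : IsHField E D) : Type u := Additive (hE.valuationSubring.ValueGroup)ˣ

/-- The value of a nonzero element, with junk value `0` at zero. -/
noncomputable def val (hE : IsHField E D) (x : E) : hE.ValGroup :=
  open Classical in
  if h : x = 0 then 0 else
    Additive.ofMul (Units.mk0 (hE.valuationSubring.valuation x)
      ((Valuation.ne_zero_iff _).mpr h))

variable (hE : IsHField E D)

theorem val_eq {x : E} (hx : x ≠ 0) :
    ((hE.val x).toMul : hE.valuationSubring.ValueGroup) = hE.valuationSubring.valuation x := by
  simp [val, hx]

theorem val_mul {x y : E} (hx : x ≠ 0) (hy : y ≠ 0) :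
    hE.val (x * y) = hE.val x + hE.val y := by
  apply Additive.toMul.injective
  ext
  rw [toMul_add, Units.val_mul, hE.val_eq hx, hE.val_eq hy, hE.val_eq (mul_ne_zero hx hy), map_mul]

theorem val_one : hE.val 1 = 0 := by
  have := hE.val_mul (one_ne_zero (α := E)) one_ne_zero
  simpa using this

theorem val_inv {x : E} (hx : x ≠ 0) : hE.val x⁻¹ = -hE.val x := by
  have := hE.val_mul hx (inv_ne_zero hx)
  rw [mul_inv_cancel₀ hx, val_one] at this
  exact (neg_eq_of_add_eq_zero_right this.symm).symm

theorem val_div {x y : E} (hx : x ≠ 0) (hy : y ≠ 0) :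
    hE.val (x / y) = hE.val x - hE.val y := by
  rw [div_eq_mul_inv, hE.val_mul hx (inv_ne_zero hy), hE.val_inv hy, sub_eq_add_neg]

theorem val_pow {x : E} (hx : x ≠ 0) (n : ℕ) : hE.val (x ^ n) = n • hE.val x := by
  induction n with
  | zero => simp [val_one]
  | succ n ih => rw [pow_succ, hE.val_mul (pow_ne_zero n hx) hx, ih, succ_nsmul]

theorem val_le_iff {x y : E} (hx : x ≠ 0) (hy : y ≠ 0) :
    hE.val x ≤ hE.val y ↔ ∃ c, D c = 0 ∧ |x| ≤ c * |y| := by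
  rw [← Additive.toMul_le, ← Units.val_le_val, hE.val_eq hx, hE.val_eq hy,
    ValuationSubring.valuation_le_iff]
  constructor
  · rintro ⟨⟨a, c, hc, hac⟩, rfl⟩
    exact ⟨c, hc, by rw [abs_mul]; exact mul_le_mul_of_nonneg_right hac (abs_nonneg y)⟩
  · rintro ⟨c, hc, h⟩
    refine ⟨⟨x / y, c, hc, ?_⟩, div_mul_cancel₀ x hy⟩
    rwa [abs_div, div_le_iff₀ (abs_pos.mpr hy)]

theorem val_lt_iff {x y : E} (hx : x ≠ 0) (hy : y ≠ 0) :
    hE.val x < hE.val y ↔ Negligible D x y := by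
  rw [← not_le, hE.val_le_iff hy hx]
  push Not
  rfl

theorem val_le_of_abs_le {x y : E} (hx : x ≠ 0) (h : |x| ≤ |y|) : hE.val x ≤ hE.val y :=
  (hE.val_le_iff hx (abs_pos.mp ((abs_pos.mpr hx).trans_le h))).mpr ⟨1, by simp, by simpa using h⟩

theorem val_neg (x : E) : hE.val (-x) = hE.val x := by
  rcases eq_or_ne x 0 with rfl | hx
  · rw [neg_zero]
  · exact le_antisymm (hE.val_le_of_abs_le (neg_ne_zero.mpr hx) (abs_neg x).le)
      (hE.val_le_of_abs_le hx (abs_neg x).ge)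

theorem val_abs (x : E) : hE.val |x| = hE.val x := by
  rcases abs_choice x with h | h <;> rw [h]
  exact hE.val_neg x

theorem exists_pos_val_eq (γ : hE.ValGroup) : ∃ x, 0 < x ∧ hE.val x = γ := by
  obtain ⟨x, hx⟩ := hE.valuationSubring.valuation_surjective (γ.toMul : _)
  have hx0 : x ≠ 0 := by
    rintro rfl
    rw [map_zero] at hx
    exact γ.toMul.ne_zero hx.symm
  refine ⟨|x|, abs_pos.mpr hx0, ?_⟩
  rw [val_abs]
  apply Additive.toMul.injective
  ext
  rw [hE.val_eq hx0, hx]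

theorem negligible_one_iff {x : E} (hx : x ≠ 0) : Negligible D 1 x ↔ 0 < hE.val x := by
  rw [← hE.val_one, hE.val_lt_iff one_ne_zero hx]

theorem val_add_of_negligible {x e : E} (h : Negligible D e x) :
    x + e ≠ 0 ∧ hE.val (x + e) = hE.val x := by
  have h2 := h 2 (by simpa using D.map_natCast 2)
  have h3 : |x| ≤ |x + e| + |e| := by
    have := abs_sub (x + e) e
    rwa [add_sub_cancel_right] at this
  have h4 := abs_add_le x e
  have hx := h.ne_zero
  have hpos := abs_pos.mpr hx
  have hne : x + e ≠ 0 := abs_pos.mp (by linarith [abs_nonneg e])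
  have hc : D 2 = 0 := by simpa using D.map_natCast 2
  exact ⟨hne, le_antisymm ((hE.val_le_iff hne hx).mpr ⟨2, hc, by linarith [abs_nonneg e]⟩)
    ((hE.val_le_iff hx hne).mpr ⟨2, hc, by linarith [abs_nonneg e]⟩)⟩

theorem logDer_lt_logDer {x y : E} (hx : 0 < x) (hy : 0 < y) (h : hE.val x < hE.val y) :
    logDer D x < logDer D y := by
  rw [← sub_pos, ← logDer_div hy.ne' hx.ne']
  apply hE.logDer_pos
  rw [hE.negligible_one_iff (div_pos hy hx).ne', hE.val_div hy.ne' hx.ne']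
  exact sub_pos.mpr h

theorem negligible_logDer_of_val_eq_zero {x a : E} (hx : x ≠ 0) (h : hE.val x = 0)
    (ha : Negligible D 1 a) : Negligible D (logDer D x) (logDer D a) := by
  obtain ⟨k, hk, hxk⟩ := (hE.val_le_iff hx one_ne_zero).mp (by rw [h, hE.val_one])
  obtain ⟨l, hl, hxl⟩ := (hE.val_le_iff (inv_ne_zero hx) one_ne_zero).mp
    (by rw [hE.val_inv hx, h, hE.val_one, neg_zero])
  rw [abs_one, mul_one] at hxk hxl
  exact hE.negligible_logDer hk hxk hl hxl ha

theorem exists_val_eq_abs {x : E} (hx : x ≠ 0) :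
    ∃ y, y ≠ 0 ∧ hE.val y = |hE.val x| ∧ (y = x ∨ y = x⁻¹) := by
  rcases le_total 0 (hE.val x) with h0 | h0
  · exact ⟨x, hx, (abs_of_nonneg h0).symm, Or.inl rfl⟩
  · exact ⟨x⁻¹, inv_ne_zero hx, by rw [hE.val_inv hx, abs_of_nonpos h0], Or.inr rfl⟩

theorem logDer_ne_zero {x : E} (hx : x ≠ 0) (h : hE.val x ≠ 0) : logDer D x ≠ 0 := by
  obtain ⟨y, hy, hyv, hyx⟩ := hE.exists_val_eq_abs hx
  have hpos := hE.logDer_pos ((hE.negligible_one_iff hy).mpr (hyv ▸ abs_pos.mpr h))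
  rcases logDer_of_eq_or_eq_inv (D := D) hx hyx with h1 | h1 <;> rw [h1] at hpos
  · exact hpos.ne'
  · exact (neg_pos.mp hpos).ne

theorem val_logDer_congr {x y : E} (hx : x ≠ 0) (hy : y ≠ 0) (h0 : hE.val x ≠ 0)
    (h : hE.val x = hE.val y) : hE.val (logDer D x) = hE.val (logDer D y) := by
  have hyx : hE.val (y / x) = 0 := by rw [hE.val_div hy hx, h, sub_self]
  obtain ⟨z, hz, hzv, hzx⟩ := hE.exists_val_eq_abs hx
  have h1 := hE.negligible_logDer_of_val_eq_zero (div_ne_zero hy hx) hyx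
    ((hE.negligible_one_iff hz).mpr (hzv ▸ abs_pos.mpr h0))
  have h2 : Negligible D (logDer D y - logDer D x) (logDer D x) := by
    rw [← logDer_div hy hx]
    rcases logDer_of_eq_or_eq_inv (D := D) hx hzx with h3 | h3 <;> rw [h3] at h1
    · exact h1
    · intro c hc
      simpa using h1 c hc
  have := (hE.val_add_of_negligible h2).2
  rw [add_sub_cancel] at this
  exact this.symm

/-- The map induced on the value group by logarithmic derivation. -/
noncomputable def psi (γ : hE.ValGroup) : hE.ValGroup :=
  hE.val (logDer D (hE.exists_pos_val_eq γ).choose)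

theorem psi_val {x : E} (hx : x ≠ 0) (h : hE.val x ≠ 0) :
    hE.psi (hE.val x) = hE.val (logDer D x) := by
  obtain ⟨h1, h2⟩ := (hE.exists_pos_val_eq (hE.val x)).choose_spec
  exact hE.val_logDer_congr h1.ne' hx (h2.trans_ne h) h2

theorem nsmul_val_logDer_sub_lt {a c : E} (ha : Negligible D 1 a) (hc : Negligible D 1 c)
    (h : hE.val (logDer D a) < hE.val (logDer D c)) (n : ℕ) :
    n • (hE.val (logDer D c) - hE.val (logDer D a)) < hE.val c := by
  have hla := (hE.logDer_pos ha).ne'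
  have hlc := (hE.logDer_pos hc).ne'
  set W := logDer D c / logDer D a with hW
  have hW0 : W ≠ 0 := div_ne_zero hlc hla
  rw [← hE.val_div hlc hla, ← hE.val_pow hW0]
  by_contra! hcon
  have hu : Negligible D W⁻¹ 1 := by
    rw [← hE.val_lt_iff (inv_ne_zero hW0) one_ne_zero, hE.val_one, hE.val_inv hW0,
      hE.val_div hlc hla]
    exact neg_lt_zero.mpr (sub_pos.mpr h)
  have h1 : Negligible D (logDer D W) (logDer D c) := by
    have h2 := ((hE.negligible_derivation hu ha).mul_right hW0).neg
    have h3 : logDer D a * W = logDer D c := mul_div_cancel₀ _ hla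
    have h4 : -(D W⁻¹ * W) = logDer D W := by
      rw [← neg_neg (logDer D W), ← logDer_inv hW0, logDer, div_inv_eq_mul]
    rwa [h3, h4] at h2
  have h2 : Negligible D (n * logDer D W) (logDer D c) := h1.natCast_mul n
  have hc0 := hc.ne_zero
  have hWn := pow_ne_zero n hW0
  have h3 : logDer D (W ^ n / c) = n * logDer D W - logDer D c := by
    rw [logDer_div hWn hc0, logDer_pow hW0]
  have hx0 := div_ne_zero hWn hc0
  rcases hcon.eq_or_lt with heq | hlt
  · have h4 := hE.negligible_logDer_of_val_eq_zero hx0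
      (by rw [hE.val_div hWn hc0, heq, sub_self]) hc
    have h5 := h2.sub h4
    rw [h3, sub_sub_cancel] at h5
    exact Negligible.irrefl _ h5
  · have h4 := hE.logDer_pos ((hE.negligible_one_iff hx0).mpr
      (by rw [hE.val_div hWn hc0]; exact sub_pos.mpr hlt))
    rw [h3] at h4
    have h5 := h2.abs_lt
    rw [abs_of_pos (hE.logDer_pos hc)] at h5
    linarith [le_abs_self (n * logDer D W)]

/-- The map `psi` is infinitely contracting. -/
theorem nsmul_abs_psi_sub_lt {α β : hE.ValGroup} (hα : α ≠ 0) (hβ : β ≠ 0) (hαβ : α ≠ β) (n : ℕ) :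
    n • |hE.psi α - hE.psi β| < |α - β| := by
  wlog h : hE.psi α ≤ hE.psi β generalizing α β
  · rw [abs_sub_comm, abs_sub_comm α]
    exact this hβ hα hαβ.symm (le_of_not_ge h)
  rcases h.eq_or_lt with heq | hlt
  · rw [heq, sub_self, abs_zero, smul_zero]
    exact abs_pos.mpr (sub_ne_zero.mpr hαβ)
  obtain ⟨a, ha, rfl⟩ := hE.exists_pos_val_eq α
  obtain ⟨b, hb, rfl⟩ := hE.exists_pos_val_eq β
  rw [hE.psi_val ha.ne' hα, hE.psi_val hb.ne' hβ] at hlt ⊢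
  have hc0 := (div_pos ha hb).ne'
  have hcv : hE.val (a / b) ≠ 0 := by
    rw [hE.val_div ha.ne' hb.ne']
    exact sub_ne_zero.mpr hαβ
  obtain ⟨a', ha', hav, haa⟩ := hE.exists_val_eq_abs ha.ne'
  obtain ⟨c', hc', hcv', hcc⟩ := hE.exists_val_eq_abs hc0
  have hval : ∀ {x y : E}, x ≠ 0 → (y = x ∨ y = x⁻¹) →
      hE.val (logDer D y) = hE.val (logDer D x) := by
    intro x y hx hxy
    rcases logDer_of_eq_or_eq_inv (D := D) hx hxy with h3 | h3 <;> rw [h3]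
    exact hE.val_neg _
  have hcb : hE.val (logDer D (a / b)) = hE.val (logDer D b) := by
    have h1 := (hE.val_add_of_negligible ((hE.val_lt_iff (hE.logDer_ne_zero ha.ne' hα)
      (hE.logDer_ne_zero hb.ne' hβ)).mp hlt).neg).2
    rw [← h1, logDer_div ha.ne' hb.ne', ← hE.val_neg, neg_sub, sub_eq_add_neg]
  have key := hE.nsmul_val_logDer_sub_lt ((hE.negligible_one_iff ha').mpr (hav ▸ abs_pos.mpr hα))
    ((hE.negligible_one_iff hc').mpr (hcv' ▸ abs_pos.mpr hcv))
    (by rw [hval ha.ne' haa, hval hc0 hcc, hcb]; exact hlt) n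
  rwa [hval ha.ne' haa, hval hc0 hcc, hcb, hcv', hE.val_div ha.ne' hb.ne',
    ← abs_of_pos (sub_pos.mpr hlt), abs_sub_comm] at key

end IsHField

end Val

/-- `f` is strictly monotone or strictly antitone. -/
def StrictMonoOrAnti {α β : Type*} [Preorder α] [Preorder β] (f : α → β) : Prop :=
  StrictMono f ∨ StrictAnti f

namespace StrictMonoOrAnti

variable {α β : Type*} [LinearOrder α]

theorem injective [Preorder β] {f : α → β} (hf : StrictMonoOrAnti f) : Function.Injective f :=
  hf.elim StrictMono.injective StrictAnti.injective

theorem comp_strictMono {κ : Type*} [Preorder κ] [Preorder β] {f : α → β}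
    (hf : StrictMonoOrAnti f) {g : κ → α} (hg : StrictMono g) : StrictMonoOrAnti (f ∘ g) :=
  hf.imp (fun h => h.comp hg) fun h => h.comp_strictMono hg

variable [AddCommGroup β] [LinearOrder β] [IsOrderedAddMonoid β]

theorem neg {f : α → β} (hf : StrictMonoOrAnti f) : StrictMonoOrAnti fun i => -f i :=
  hf.symm.imp StrictAnti.neg StrictMono.neg

end StrictMonoOrAnti

section Step

variable {E : Type u} [Field E] [LinearOrder E] [IsStrictOrderedRing E] {D : Derivation ℤ E E}

namespace IsHField

variable (hE : IsHField E D)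

include hE in
theorem exists_constant_negligible_sub {z c : E} (hc : D c = 0) (hz : |z| ≤ c) :
    ∃ k, D k = 0 ∧ Negligible D (z - k) 1 := by
  obtain ⟨k, e, hk, he, rfl⟩ := (hE.h2 z).mp ⟨c, hc, hz⟩
  refine ⟨k, hk, fun c hc => ?_⟩
  rw [add_sub_cancel_left, abs_one]
  rcases le_or_gt c 0 with h | h
  · exact (mul_nonpos_of_nonpos_of_nonneg h (abs_nonneg e)).trans_lt one_pos
  · have := he c⁻¹ (derivation_inv_eq_zero hc) (inv_pos.mpr h)
    rwa [← one_div, lt_div_iff₀' h] at this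

theorem le_of_negligible_sub {z z' k k' : E} (hk : D k = 0) (hk' : D k' = 0)
    (hz : Negligible D (z - k) 1) (hz' : Negligible D (z' - k') 1) (h : z ≤ z') : k ≤ k' := by
  by_contra! hlt
  have h1 := (hz.sub hz') (k - k')⁻¹ (derivation_inv_eq_zero (by simp [hk, hk']))
  rw [abs_one, ← div_eq_inv_mul, div_lt_one (sub_pos.mpr hlt)] at h1
  linarith [neg_abs_le (z - k - (z' - k'))]

variable {I : Type u} [LinearOrder I]

theorem exists_val_sub_ne (hC : IsShort {x : E // D x = 0}) (hI : IsLong I) {y : I → E}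
    (hy : StrictMono y) (τ : I → I) (hτ : ∀ i, i < τ i)
    (hval : ∀ i j, τ i ≤ j → hE.val (y j - y i) = hE.val (y (τ i) - y i)) (i : I) :
    ∃ j, i ≤ j ∧ hE.val (y (τ j) - y j) ≠ hE.val (y (τ i) - y i) := by
  by_contra! hcon
  set w := y (τ i) - y i with hw
  have hpos : 0 < w := sub_pos.mpr (hy (hτ i))
  have hres : ∀ j, ∃ k : {x : E // D x = 0},
      Negligible D ((y (max j (τ i)) - y i) / w - k) 1 := by
    intro j
    have h1 := sub_pos.mpr (hy ((hτ i).trans_le (le_max_right j (τ i))))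
    obtain ⟨c, hc, hle⟩ := (hE.val_le_iff h1.ne' hpos.ne').mp
      (hval i _ (le_max_right j (τ i))).le
    obtain ⟨k, hk, hneg⟩ := hE.exists_constant_negligible_sub hc
      (z := (y (max j (τ i)) - y i) / w)
      (by rwa [abs_div, div_le_iff₀ (abs_pos.mpr hpos.ne')])
    exact ⟨⟨k, hk⟩, hneg⟩
  choose k hk using hres
  obtain ⟨m, hm⟩ := hC.eventually_const_of_monotone hI (f := k) fun a b hab =>
    Subtype.coe_le_coe.mp <| le_of_negligible_sub (k a).2 (k b).2 (hk a) (hk b) ((div_le_div_iff_of_pos_right hpos).mpr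
      (sub_le_sub_right (hy.monotone (max_le_max_right _ hab)) _))
  set l := max m (τ i)
  set r := max l (τ l)
  have h1 : max l (τ i) = l := max_eq_left (le_max_right _ _)
  have h2 : max r (τ i) = r := max_eq_left ((le_max_right _ _).trans (le_max_left _ _))
  have hkl := hk l
  have hkr := hk r
  rw [h1, hm l (le_max_left _ _)] at hkl
  rw [h2, hm r ((le_max_left _ _).trans (le_max_left _ _))] at hkr
  have h3 := (hkr.sub hkl).mul_right hpos.ne'
  rw [sub_sub_sub_cancel_right, ← sub_div, div_mul_cancel₀ _ hpos.ne', one_mul,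
    sub_sub_sub_cancel_right] at h3
  have hlr : y r - y l ≠ 0 := (sub_pos.mpr (hy ((hτ l).trans_le (le_max_right _ _)))).ne'
  have h4 := (hE.val_lt_iff hlr hpos.ne').mpr h3
  rw [hval l r (le_max_right _ _), hcon l ((hτ i).le.trans (le_max_right _ _))] at h4
  exact lt_irrefl _ h4

theorem exists_step_of_strictMono (hC : IsShort {x : E // D x = 0}) (hI : IsLong I) {y : I → E}
    (hy : StrictMono y) :
    ∃ (T : Set I) (η : T → hE.ValGroup), IsCofinal T ∧ StrictMonoOrAnti η ∧
      ∀ F : Finset T, ∃ e : I, ∀ t ∈ F, y t ≠ y e ∧ η t = hE.val (y t - y e) := by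
  by_cases h : ∀ i, ∃ τ, i < τ ∧ ∀ j, τ ≤ j → hE.val (y j - y i) = hE.val (y τ - y i)
  · choose τ hτ hval using h
    have hanti : Antitone fun i => hE.val (y (τ i) - y i) := by
      intro i j hij
      set l := max (τ i) (τ j)
      simp only
      rw [← hval i l (le_max_left _ _), ← hval j l (le_max_right _ _)]
      have h1 := sub_pos.mpr (hy ((hτ j).trans_le (le_max_right (τ i) (τ j))))
      have h2 := hy.monotone hij
      exact hE.val_le_of_abs_le h1.ne' (abs_le_abs_of_nonneg h1.le (sub_le_sub_left h2 _))
    obtain ⟨T, hT, hTη⟩ := hanti.exists_isCofinal_strictAnti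
      (hE.exists_val_sub_ne hC hI hy τ hτ hval)
    refine ⟨T, _, hT, Or.inr hTη, fun F => ?_⟩
    obtain ⟨e, he⟩ := hI.exists_forall_gt fun t : F => τ t
    refine ⟨e, fun t ht => ⟨hy.injective.ne ((hτ t).trans (he ⟨t, ht⟩)).ne, ?_⟩⟩
    rw [← hE.val_neg (y t - y e), neg_sub, hval t e (he ⟨t, ht⟩).le]
  · push Not at h
    obtain ⟨i, hi⟩ := h
    obtain ⟨s, hs⟩ := hI.exists_gt i
    have hpos : ∀ j, 0 < y (max j s) - y i :=
      fun j => sub_pos.mpr (hy (hs.trans_le (le_max_right _ _)))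
    have hmono : Monotone fun j => hE.val (y (max j s) - y i) := by
      intro a b hab
      exact hE.val_le_of_abs_le (hpos a).ne' (abs_le_abs_of_nonneg (hpos a).le
        (sub_le_sub_right (hy.monotone (max_le_max_right s hab)) _))
    obtain ⟨T, hT, hTη⟩ := hmono.exists_isCofinal_strictMono fun j => by
      obtain ⟨l, hl, hne⟩ := hi (max j s) (hs.trans_le (le_max_right _ _))
      refine ⟨l, (le_max_left _ _).trans hl, ?_⟩
      rwa [max_eq_left ((le_max_right _ _).trans hl)]
    refine ⟨T ∩ Set.Ici s, fun t => hE.val (y t - y i), fun j => ?_, Or.inl fun a b hab => ?_,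
      fun F => ⟨i, fun t _ => ⟨hy.injective.ne (hs.trans_le t.2.2).ne', rfl⟩⟩⟩
    · obtain ⟨t, ht, hjt⟩ := hT (max j s)
      exact ⟨t, ⟨ht, (le_max_right _ _).trans hjt⟩, (le_max_left _ _).trans hjt⟩
    · have := hTη (show (⟨a, a.2.1⟩ : T) < ⟨b, b.2.1⟩ from hab)
      simpa only [max_eq_left a.2.2.out, max_eq_left b.2.2.out] using this

theorem exists_step (hC : IsShort {x : E // D x = 0}) (hI : IsLong I) {y : I → E}
    (hy : StrictMonoOrAnti y) :
    ∃ (T : Set I) (η : T → hE.ValGroup), IsCofinal T ∧ StrictMonoOrAnti η ∧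
      ∀ F : Finset T, ∃ e : I, ∀ t ∈ F, y t ≠ y e ∧ η t = hE.val (y t - y e) := by
  rcases hy with hy | hy
  · exact hE.exists_step_of_strictMono hC hI hy
  · obtain ⟨T, η, hT, hη, h⟩ := hE.exists_step_of_strictMono hC hI hy.neg
    refine ⟨T, η, hT, hη, fun F => ?_⟩
    obtain ⟨e, he⟩ := h F
    refine ⟨e, fun t ht => ⟨fun h1 => (he t ht).1 ?_, ?_⟩⟩
    · simp [h1]
    · rw [(he t ht).2, ← hE.val_neg (y t - y e)]
      congr 1
      ring

/-- The analogue of `exists_step` in the value group, with differences fed through `psi`. -/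
theorem exists_psi_step (hC : IsShort {x : E // D x = 0}) (hI : IsLong I) {γ : I → hE.ValGroup}
    (hγ : StrictMonoOrAnti γ) :
    ∃ (T : Set I) (η : T → hE.ValGroup), IsCofinal T ∧ StrictMonoOrAnti η ∧
      ∀ F : Finset T, ∃ e : I, ∀ t ∈ F, γ t ≠ γ e ∧ η t = hE.psi (γ t - γ e) := by
  choose b hb hbγ using fun i => hE.exists_pos_val_eq (γ i)
  have hlt : ∀ i j, γ i < γ j → logDer D (b i) < logDer D (b j) := fun i j h =>
    hE.logDer_lt_logDer (hb i) (hb j) (by rwa [hbγ, hbγ])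
  obtain ⟨T, η, hT, hη, h⟩ := hE.exists_step hC hI (y := fun i => logDer D (b i))
    (hγ.imp (fun h i j hij => hlt i j (h hij)) fun h i j hij => hlt j i (h hij))
  refine ⟨T, η, hT, hη, fun F => ?_⟩
  obtain ⟨e, he⟩ := h F
  refine ⟨e, fun t ht => ?_⟩
  obtain ⟨hne, hval⟩ := he t ht
  have hte : γ t ≠ γ e := hγ.injective.ne fun h => hne (by rw [h])
  refine ⟨hte, ?_⟩
  rw [hval, ← logDer_div (hb _).ne' (hb _).ne', ← hbγ t, ← hbγ e,
    ← hE.val_div (hb _).ne' (hb _).ne', hE.psi_val (div_pos (hb _) (hb _)).ne']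
  rw [hE.val_div (hb _).ne' (hb _).ne', hbγ, hbγ]
  exact sub_ne_zero.mpr hte

end IsHField

end Step

section Tower

theorem StrictMonoOrAnti.add_of_abs_sub_lt {α β : Type*} [LinearOrder α] [AddCommGroup β]
    [LinearOrder β] [IsOrderedAddMonoid β] {f g : α → β} (hf : StrictMonoOrAnti f)
    (h : ∀ i j, i ≠ j → |g i - g j| < |f i - f j|) : StrictMonoOrAnti fun i => f i + g i := by
  refine hf.imp (fun hf i j hij => ?_) fun hf i j hij => ?_ <;> have h1 := h i j hij.ne
  · rw [abs_sub_comm (f i), abs_of_pos (sub_pos.mpr (hf hij))] at h1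
    have := (le_abs_self _).trans_lt h1
    rwa [sub_lt_sub_iff, add_comm (g i)] at this
  · rw [abs_of_pos (sub_pos.mpr (hf hij)), abs_sub_comm] at h1
    have := (le_abs_self _).trans_lt h1
    rwa [sub_lt_sub_iff, add_comm (g j)] at this

theorem StrictMonoOrAnti.zsmul {α β : Type*} [LinearOrder α] [AddCommGroup β]
    [LinearOrder β] [IsOrderedAddMonoid β] {f : α → β} (hf : StrictMonoOrAnti f) {n : ℤ}
    (hn : n ≠ 0) : StrictMonoOrAnti fun i => n • f i := by
  wlog h : 0 < n generalizing n f
  · simpa using this hf.neg (neg_ne_zero.mpr hn) (by omega)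
  exact hf.imp (fun hf i j hij => zsmul_lt_zsmul_right h (hf hij))
    fun hf i j hij => zsmul_lt_zsmul_right h (hf hij)

variable {E : Type u} [Field E] [LinearOrder E] [IsStrictOrderedRing E] {D : Derivation ℤ E E}

theorem IsHField.exists_tower (hE : IsHField E D) (hC : IsShort {x : E // D x = 0}) (L : ℕ)
    {I : Type u} [LinearOrder I] (hI : IsLong I) {γ : I → hE.ValGroup}
    (hγ : StrictMonoOrAnti γ) :
    ∃ (J : Type u) (_ : LinearOrder J) (φ : J → I) (η : Fin (L + 1) → J → hE.ValGroup),
      IsLong J ∧ StrictMono φ ∧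
      (∀ q : Fin (L + 1) → ℤ, q ≠ 0 → StrictMonoOrAnti fun j => ∑ k, q k • η k j) ∧
      (∀ q : Fin (L + 1) → ℤ, ∃ M : ℕ, ∀ i j,
        |∑ k, q k • η k i - ∑ k, q k • η k j| ≤ M • |γ (φ i) - γ (φ j)|) ∧
      ∀ F : Finset J, ∃ F' : Finset I, F'.card ≤ F.card + L ∧ (∀ j ∈ F, φ j ∈ F') ∧
        ∀ S : Set hE.ValGroup, (∀ a ∈ S, ∀ b ∈ S, a ≠ b → hE.psi (a - b) ∈ S) →
          (∀ i ∈ F', γ i ∈ S) → ∀ j ∈ F, ∀ k, η k j ∈ S := by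
  induction L generalizing I with
  | zero =>
    refine ⟨I, inferInstance, id, fun _ => γ, hI, strictMono_id, fun q hq => ?_,
      fun q => ⟨(q 0).natAbs, fun i j => ?_⟩, fun F => ⟨F, le_rfl, fun _ h => h,
      fun S _ hS j hj _ => hS j hj⟩⟩
    · simp only [Nat.reduceAdd, Fin.sum_univ_one]
      exact hγ.zsmul fun h => hq (by ext k; rw [Fin.fin_one_eq_zero k, h]; rfl)
    · simp only [Nat.reduceAdd, Fin.sum_univ_one]
      rw [← smul_sub, abs_zsmul, Int.abs_eq_natAbs, natCast_zsmul, id, id]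
  | succ L ih =>
    obtain ⟨T, ηT, hT, hηT, hstep⟩ := hE.exists_psi_step hC hI hγ
    obtain ⟨J, _, φ, η, hJ, hφ, hmono, hbound, hfin⟩ := ih (hI.subtype hT) hηT
    have hcontr : ∀ s t : T, s ≠ t → ∀ n : ℕ, n • |ηT s - ηT t| < |γ s - γ t| := by
      intro s t hst n
      obtain ⟨e, he⟩ := hstep {s, t}
      obtain ⟨hs, hs'⟩ := he s (by simp)
      obtain ⟨ht, ht'⟩ := he t (by simp)
      have hne : γ s ≠ γ t := hγ.injective.ne (Subtype.coe_injective.ne hst)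
      rw [hs', ht', ← sub_sub_sub_cancel_right (γ s) (γ t) (γ e)]
      exact hE.nsmul_abs_psi_sub_lt (sub_ne_zero.mpr hs) (sub_ne_zero.mpr ht)
        (sub_left_injective.ne hne) n
    have hsmall : ∀ q : Fin (L + 1) → ℤ, ∀ i j, i ≠ j →
        |∑ k, q k • η k i - ∑ k, q k • η k j| < |γ (φ i) - γ (φ j)| := by
      intro q i j hij
      obtain ⟨M, hM⟩ := hbound q
      exact (hM i j).trans_lt (hcontr _ _ (hφ.injective.ne hij) M)
    have hφ' : StrictMono fun j => (φ j : I) := hφ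
    refine ⟨J, inferInstance, fun j => φ j, Fin.cons (fun j => γ (φ j)) η, hJ, hφ, fun q hq => ?_,
      fun q => ⟨(q 0).natAbs + 1, fun i j => ?_⟩, fun F => ?_⟩
    · simp only [Fin.sum_univ_succ (n := L + 1), Fin.cons_zero, Fin.cons_succ]
      rcases eq_or_ne (q 0) 0 with h0 | h0
      · simp only [h0, zero_smul, zero_add]
        refine hmono (fun k => q k.succ) fun h => hq ?_
        ext k
        refine Fin.cases h0 (fun k => congrFun h k) k
      · refine ((hγ.comp_strictMono hφ').zsmul h0).add_of_abs_sub_lt fun i j hij => ?_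
        refine (hsmall _ i j hij).trans_le ?_
        simp only [Function.comp]
        rw [← smul_sub, abs_zsmul]
        calc _ = (1 : ℤ) • |γ (φ i) - γ (φ j)| := (one_zsmul _).symm
          _ ≤ _ := zsmul_le_zsmul_left (abs_nonneg _) (Int.one_le_abs h0)
    · simp only [Fin.sum_univ_succ (n := L + 1), Fin.cons_zero, Fin.cons_succ]
      rw [add_sub_add_comm, ← smul_sub, add_nsmul, one_nsmul]
      refine (abs_add_le _ _).trans (add_le_add ?_ ?_)
      · rw [abs_zsmul, Int.abs_eq_natAbs, natCast_zsmul]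
      · rcases eq_or_ne i j with rfl | hij
        · simp
        · exact (hsmall _ i j hij).le
    · classical
      obtain ⟨F₁, hcard, hmem, hclosed⟩ := hfin F
      obtain ⟨e, he⟩ := hstep F₁
      refine ⟨insert e (F₁.image Subtype.val), ?_, fun j hj => ?_, fun S hS hF j hj k => ?_⟩
      · have h1 := Finset.card_insert_le e (F₁.image Subtype.val)
        have h2 : (F₁.image Subtype.val).card ≤ F₁.card := Finset.card_image_le
        omega
      · exact Finset.mem_insert_of_mem (Finset.mem_image_of_mem _ (hmem j hj))
      · have hF₁ : ∀ t ∈ F₁, γ t ∈ S := fun t ht =>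
          hF t (Finset.mem_insert_of_mem (Finset.mem_image_of_mem _ ht))
        refine Fin.cases (hF₁ _ (hmem j hj)) (fun k => ?_) k
        refine hclosed S hS (fun t ht => ?_) j hj k
        obtain ⟨hne, hval⟩ := he t ht
        rw [hval]
        exact hS _ (hF₁ t ht) _ (hF e (Finset.mem_insert_self _ _)) hne

end Tower

section Algebraic

variable {E : Type u} [Field E] (D : Derivation ℤ E E)

theorem IsAlgebraic.derivation [CharZero E] {R : Type*} [CommRing R] [IsDomain R] [Algebra R E]
    [FaithfulSMul R E] (hR : ∀ r : R, IsAlgebraic R (D (algebraMap R E r))) {y : E}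
    (hy : IsAlgebraic R y) : IsAlgebraic R (D y) := by
  classical
  have : CharZero R := (algebraMap R E).charZero
  have hex : ∃ n, ∃ p : Polynomial R, p ≠ 0 ∧ Polynomial.aeval y p = 0 ∧ p.natDegree = n := by
    obtain ⟨p, hp, hpy⟩ := hy
    exact ⟨_, p, hp, hpy, rfl⟩
  obtain ⟨p, hp, hpy, hdeg⟩ := Nat.find_spec hex
  have hdeg0 : p.natDegree ≠ 0 := by
    intro h
    rw [Polynomial.eq_C_of_natDegree_eq_zero h, Polynomial.aeval_C,
      FaithfulSMul.algebraMap_eq_zero_iff] at hpy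
    exact hp (by rw [Polynomial.eq_C_of_natDegree_eq_zero h, hpy, Polynomial.C_0])
  have hder : Polynomial.aeval y (Polynomial.derivative p) ≠ 0 := by
    intro h
    have hlt := Polynomial.natDegree_derivative_lt hdeg0
    refine Nat.find_min hex (hdeg ▸ hlt) ⟨_, fun h0 => hdeg0 ?_, h, rfl⟩
    exact Polynomial.derivative_eq_zero.mp h0
  have hleib : ∀ f : Polynomial R, IsAlgebraic R
      (D (Polynomial.aeval y f) - Polynomial.aeval y (Polynomial.derivative f) * D y) := by
    intro f
    induction f using Polynomial.induction_on' with
    | add f g hf hg =>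
      rw [map_add, map_add, map_add, map_add, add_mul, add_sub_add_comm]
      exact hf.add hg
    | monomial n a =>
      have h1 : D (Polynomial.aeval y (Polynomial.monomial n a)) -
          Polynomial.aeval y (Polynomial.derivative (Polynomial.monomial n a)) * D y =
          D (algebraMap R E a) * y ^ n := by
        rw [Polynomial.derivative_monomial, Polynomial.aeval_monomial, Polynomial.aeval_monomial]
        simp only [Derivation.leibniz, Derivation.leibniz_pow, map_mul, map_natCast, smul_eq_mul,
          nsmul_eq_mul]
        ring
      rw [h1]
      exact (hR a).mul (hy.pow n)
  have hle : Algebra.adjoin R {y} ≤ Subalgebra.algebraicClosure R E :=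
    Algebra.adjoin_le (Set.singleton_subset_iff.mpr hy)
  have h1 : IsAlgebraic R (Polynomial.aeval y (Polynomial.derivative p)) :=
    hle (Polynomial.aeval_mem_adjoin_singleton R y)
  have h2 := (hleib p).neg.mul h1.inv
  rwa [hpy, map_zero, zero_sub, neg_neg, mul_comm, inv_mul_cancel_left₀ hder] at h2

variable {D} {H : Subfield E}

theorem isAlgebraic_adjoin_derivation [CharZero E] (hH : ∀ x ∈ H, D x ∈ H) {s : Set E}
    (hs : ∀ x ∈ s, IsAlgebraic (Algebra.adjoin H s) (D x)) {y : E}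
    (hy : IsAlgebraic (Algebra.adjoin H s) y) : IsAlgebraic (Algebra.adjoin H s) (D y) := by
  refine IsAlgebraic.derivation D (fun r => ?_) hy
  obtain ⟨r, hr⟩ := r
  have halg : ∀ x ∈ Algebra.adjoin H s, IsAlgebraic (Algebra.adjoin H s) x := fun x hx =>
    isAlgebraic_algebraMap (⟨x, hx⟩ : Algebra.adjoin H s)
  change IsAlgebraic (Algebra.adjoin H s) (D r)
  induction hr using Algebra.adjoin_induction with
  | mem x hx => exact hs x hx
  | algebraMap r => exact halg _ (Subalgebra.algebraMap_mem _ (⟨D r, hH r r.2⟩ : H))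
  | add x y _ _ hx hy => rw [map_add]; exact hx.add hy
  | mul x y hx hy hDx hDy =>
    rw [Derivation.leibniz]
    exact ((halg x hx).mul hDy).add ((halg y hy).mul hDx)

theorem exists_isAlgebraic_iterate {f : E → E} {e : E}
    (h : ¬ AlgebraicIndependent H fun n => f^[n] e) :
    ∃ n, IsAlgebraic (Algebra.adjoin H ((fun k => f^[k] e) '' Set.Iio n)) (f^[n] e) := by
  by_contra! hcon
  have hind : ∀ n, AlgebraicIndepOn H (fun k => f^[k] e) (Set.Iio n) := by
    intro n
    induction n with
    | zero =>
      have : IsEmpty (Set.Iio 0) := by simp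
      exact algebraicIndependent_empty_type_iff.mpr (FaithfulSMul.algebraMap_injective H E)
    | succ n ih =>
      rw [← Order.succ_eq_add_one, Order.Iio_succ_eq_insert]
      exact ih.insert (hcon n)
  refine h (algebraicIndependent_of_finite_type fun t ht => ?_)
  obtain ⟨n, hn⟩ := ht.bddAbove
  exact (hind (n + 1)).mono fun k hk => Nat.lt_succ_of_le (hn hk)

theorem card_le_of_algebraicIndependent {F : Type*} [Field F] [Algebra F E] {ι : Type*} [Finite ι]
    {x : ι → E} (hx : AlgebraicIndependent F x) {s : Finset E}
    (hs : ∀ i, IsAlgebraic (Algebra.adjoin F (s : Set E)) (x i)) : Nat.card ι ≤ s.card := by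
  have h1 : (AlgebraicIndependent.matroid F E).Indep (Set.range x) :=
    AlgebraicIndependent.matroid_indep_iff.mpr hx.to_subtype_range
  have h2 : Set.range x ⊆ (AlgebraicIndependent.matroid F E).closure s := by
    rintro _ ⟨i, rfl⟩
    rw [AlgebraicIndependent.matroid_closure_eq]
    exact hs i
  have h3 := h1.encard_le_eRk_of_subset h2
  rw [Matroid.eRk_closure_eq] at h3
  have h4 := h3.trans (Matroid.eRk_le_encard _ _)
  rw [Set.encard_coe_eq_coe_finsetCard, ← Set.image_univ, hx.injective.encard_image,
    Set.encard_univ, ENat.card_eq_coe_natCard] at h4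
  exact_mod_cast h4

end Algebraic

section Independence

variable {E : Type u} [Field E] [LinearOrder E] [IsStrictOrderedRing E] {D : Derivation ℤ E E}

namespace IsHField

variable (hE : IsHField E D)

theorem val_prod {ι : Type*} (s : Finset ι) {x : ι → E} (hx : ∀ i, x i ≠ 0) :
    hE.val (∏ i ∈ s, x i) = ∑ i ∈ s, hE.val (x i) := by
  classical
  induction s using Finset.induction_on with
  | empty => simp [hE.val_one]
  | insert i s hi ih =>
    rw [Finset.prod_insert hi, Finset.sum_insert hi,
      hE.val_mul (hx i) (Finset.prod_ne_zero_iff.mpr fun i _ => hx i), ih]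

theorem sum_ne_zero_of_injOn_val {ι : Type*} {s : Finset ι} (hs : s.Nonempty) {f : ι → E}
    (hf : ∀ i ∈ s, f i ≠ 0) (hinj : Set.InjOn (fun i => hE.val (f i)) s) :
    ∑ i ∈ s, f i ≠ 0 ∧ ∃ i ∈ s, hE.val (∑ i ∈ s, f i) = hE.val (f i) := by
  classical
  induction hs using Finset.Nonempty.cons_induction with
  | singleton a => simpa using hf a (by simp)
  | cons a s ha hs ih =>
    obtain ⟨hne, i, hi, hval⟩ := ih (fun i hi => hf i (Finset.mem_cons_of_mem hi))
      (hinj.mono fun i hi => Finset.mem_cons_of_mem hi)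
    rw [Finset.sum_cons]
    have hfa := hf a (Finset.mem_cons_self a s)
    have hav : hE.val (f a) ≠ hE.val (∑ i ∈ s, f i) := by
      rw [hval]
      intro h
      have := hinj (Finset.mem_cons_self a s) (Finset.mem_cons_of_mem hi) h
      exact ha (this ▸ hi)
    rcases hav.lt_or_gt with h | h
    · rw [add_comm]
      obtain ⟨h1, h2⟩ := hE.val_add_of_negligible ((hE.val_lt_iff hfa hne).mp h)
      exact ⟨h1, i, Finset.mem_cons_of_mem hi, h2.trans hval⟩
    · obtain ⟨h1, h2⟩ := hE.val_add_of_negligible ((hE.val_lt_iff hne hfa).mp h)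
      exact ⟨h1, a, Finset.mem_cons_self a s, h2⟩

/-- The value group of a subfield. -/
def valueSubgroup (H : Subfield E) : AddSubgroup hE.ValGroup where
  carrier := {γ | ∃ h ∈ H, h ≠ 0 ∧ hE.val h = γ}
  zero_mem' := ⟨1, H.one_mem, one_ne_zero, hE.val_one⟩
  add_mem' := by
    rintro _ _ ⟨x, hx, hx0, rfl⟩ ⟨y, hy, hy0, rfl⟩
    exact ⟨x * y, H.mul_mem hx hy, mul_ne_zero hx0 hy0, hE.val_mul hx0 hy0⟩
  neg_mem' := by
    rintro _ ⟨x, hx, hx0, rfl⟩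
    exact ⟨x⁻¹, H.inv_mem hx, inv_ne_zero hx0, hE.val_inv hx0⟩

theorem algebraicIndependent_of_val {H : Subfield E} {ι : Type*} [Fintype ι] {x : ι → E}
    (hx : ∀ i, x i ≠ 0)
    (h : ∀ k : ι → ℤ, ∑ i, k i • hE.val (x i) ∈ hE.valueSubgroup H → k = 0) :
    AlgebraicIndependent H x := by
  rw [algebraicIndependent_iff]
  intro p hp
  by_contra hp0
  rw [MvPolynomial.aeval_def, MvPolynomial.eval₂_eq'] at hp
  have hcoeff : ∀ d ∈ p.support, algebraMap H E (p.coeff d) ≠ 0 := fun d hd => by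
    rw [Ne, FaithfulSMul.algebraMap_eq_zero_iff]
    exact MvPolynomial.mem_support_iff.mp hd
  have hprod : ∀ d : ι →₀ ℕ, ∏ i, x i ^ d i ≠ 0 := fun d =>
    Finset.prod_ne_zero_iff.mpr fun i _ => pow_ne_zero _ (hx i)
  refine (hE.sum_ne_zero_of_injOn_val (MvPolynomial.support_nonempty.mpr hp0)
    (fun d hd => mul_ne_zero (hcoeff d hd) (hprod d)) fun d hd d' hd' heq => ?_).1 hp
  simp only at heq
  rw [hE.val_mul (hcoeff d hd) (hprod d), hE.val_mul (hcoeff d' hd') (hprod d'),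
    hE.val_prod _ fun i => pow_ne_zero _ (hx i), hE.val_prod _ fun i => pow_ne_zero _ (hx i)] at heq
  have hk := h (fun i => (d i : ℤ) - d' i) ?_
  · ext i
    have := congrFun hk i
    simp only [Pi.zero_apply] at this
    omega
  · have h1 : ∑ i, ((d i : ℤ) - d' i) • hE.val (x i) =
        hE.val (algebraMap H E (p.coeff d')) - hE.val (algebraMap H E (p.coeff d)) := by
      simp only [hE.val_pow (hx _)] at heq
      simp only [sub_smul, natCast_zsmul, Finset.sum_sub_distrib]
      rw [sub_eq_sub_iff_add_eq_add, add_comm, heq]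
    rw [h1]
    exact sub_mem ⟨_, (p.coeff d').2, hcoeff d' hd', rfl⟩ ⟨_, (p.coeff d).2, hcoeff d hd, rfl⟩

variable {H : Subfield E}

theorem exists_sub_notMem_valueSubgroup (hH : IsShort H) {I : Type*} [LinearOrder I]
    (hI : IsLong I) {g : I → hE.ValGroup} (hg : StrictMonoOrAnti g) (y : hE.ValGroup) :
    ∃ b, ∀ i, b ≤ i → g i - y ∉ hE.valueSubgroup H := by
  by_contra! hcon
  have key : ∀ {y : hE.ValGroup} {T : Set I}, IsCofinal T → ∀ {g : T → hE.ValGroup},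
      (∀ i, g i - y ∈ hE.valueSubgroup H) → ¬ StrictMono g := by
    intro y T hT g hmem hg
    choose h hh h0 hval using hmem
    have habs : ∀ i, |h i| ∈ H := fun i => by
      rcases abs_choice (h i) with h1 | h1 <;> rw [h1]
      exacts [hh i, neg_mem (hh i)]
    refine hH.not_strictMono (hI.subtype hT) (fun i => ⟨|h i|, habs i⟩) fun i j hij => ?_
    refine ((hE.val_lt_iff (h0 i) (h0 j)).mp ?_).abs_lt
    rw [hval, hval]
    exact sub_lt_sub_right (hg hij) y
  have hT : IsCofinal {i | g i - y ∈ hE.valueSubgroup H} := fun b => by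
    obtain ⟨i, hi, hmem⟩ := hcon b
    exact ⟨i, hmem, hi⟩
  rcases hg with hg | hg
  · exact key (y := y) hT (g := fun i => g i) (fun i => i.2) fun i j hij => hg hij
  · refine key (y := -y) hT (g := fun i => -g i) (fun i => ?_) fun i j hij => neg_lt_neg (hg hij)
    have := neg_mem i.2.out
    rwa [neg_sub, sub_eq_neg_add, ← sub_neg_eq_add] at this

theorem exists_independent_tuple (hH : IsShort H) {J : Type*} [LinearOrder J] (hJ : IsLong J)
    {κ : Type*} [Fintype κ] {η : κ → J → hE.ValGroup}
    (hη : ∀ q : κ → ℤ, q ≠ 0 → StrictMonoOrAnti fun j => ∑ k, q k • η k j) (m : ℕ) :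
    ∃ δ : Fin m → J, ∀ q : Fin m → κ → ℤ,
      ∑ j, ∑ k, q j k • η k (δ j) ∈ hE.valueSubgroup H → q = 0 := by
  induction m with
  | zero => exact ⟨Fin.elim0, fun q _ => Subsingleton.elim _ _⟩
  | succ m ih =>
    obtain ⟨δ, hδ⟩ := ih
    choose b hb using fun p : {q : κ → ℤ // q ≠ 0} × (Fin m → κ → ℤ) =>
      hE.exists_sub_notMem_valueSubgroup hH hJ (hη p.1 p.1.2)
        (-∑ j, ∑ k, p.2 j k • η k (δ j))
    obtain ⟨i, hi⟩ := hJ.exists_forall_gt b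
    refine ⟨Fin.cons i δ, fun q hq => ?_⟩
    rw [Fin.sum_univ_succ] at hq
    simp only [Fin.cons_zero, Fin.cons_succ] at hq
    by_cases h0 : q 0 = 0
    · have htail := hδ (fun j => q j.succ) (by simpa [h0] using hq)
      ext j : 1
      exact Fin.cases h0 (fun j => congrFun htail j) j
    · refine absurd hq ?_
      rw [← sub_neg_eq_add]
      exact hb (⟨q 0, h0⟩, fun j => q j.succ) i (hi _).le

/-- If the relative algebraic closure of `H(s)` in `E` is closed under `D`, then its value group
is closed under `psi`. -/
theorem psi_sub_mem_val_isAlgebraic (hH : ∀ x ∈ H, D x ∈ H) {s : Set E}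
    (hs : ∀ x ∈ s, IsAlgebraic (Algebra.adjoin H s) (D x)) {a b : hE.ValGroup}
    (ha : ∃ x, x ≠ 0 ∧ IsAlgebraic (Algebra.adjoin H s) x ∧ hE.val x = a)
    (hb : ∃ x, x ≠ 0 ∧ IsAlgebraic (Algebra.adjoin H s) x ∧ hE.val x = b) (hab : a ≠ b) :
    ∃ x, x ≠ 0 ∧ IsAlgebraic (Algebra.adjoin H s) x ∧ hE.val x = hE.psi (a - b) := by
  obtain ⟨x, hx0, hx, rfl⟩ := ha
  obtain ⟨y, hy0, hy, rfl⟩ := hb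
  have hxy0 := div_ne_zero hx0 hy0
  have hxy : IsAlgebraic (Algebra.adjoin H s) (x / y) := by
    rw [div_eq_mul_inv]
    exact hx.mul hy.inv
  rw [← sub_ne_zero, ← hE.val_div hx0 hy0] at hab
  rw [← hE.val_div hx0 hy0]
  refine ⟨_, hE.logDer_ne_zero hxy0 hab, ?_, (hE.psi_val hxy0 hab).symm⟩
  rw [logDer, div_eq_mul_inv]
  exact (isAlgebraic_adjoin_derivation hH hs hxy).mul hxy.inv

include hE in
theorem isShort_of_isAlgebraic_iterate (hD : ∀ x ∈ H, D x ∈ H) (hH : IsShort H)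
    (hC : IsShort {x : E // D x = 0})
    (halg : ∀ e, ∃ n, IsAlgebraic (Algebra.adjoin H ((fun k => D^[k] e) '' Set.Iio n))
      (D^[n] e)) : IsShort E := by
  classical
  by_contra hshort
  obtain ⟨I₀, _, f, hI₀, hf⟩ := exists_isLong_strictMono_of_not_isShort hshort
  obtain ⟨T₀, γ₀, hT₀, hγ₀, -⟩ := hE.exists_step hC hI₀ (Or.inl hf)
  have hI₁ := hI₀.subtype hT₀
  choose a₀ ha₀ ha₀γ using fun i => hE.exists_pos_val_eq (γ₀ i)
  choose r hr using fun i => halg (a₀ i)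
  obtain ⟨n, hn⟩ := hI₁.exists_isCofinal_fiber r
  set I := {i | r i = n}
  set a : I → E := fun i => a₀ i
  have han : ∀ i, IsAlgebraic (Algebra.adjoin H ((fun k => D^[k] (a i)) '' Set.Iio n))
      (D^[n] (a i)) := by
    intro i
    have := hr i
    rwa [show r i = n from i.2] at this
  obtain ⟨J, _, φ, η, hJ, -, hη, -, hfin⟩ := hE.exists_tower hC n (hI₁.subtype hn)
    (hγ₀.comp_strictMono (Subtype.strictMono_coe I))
  obtain ⟨δ, hδ⟩ := hE.exists_independent_tuple hH hJ hη (n ^ 2 + 1)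
  obtain ⟨F, hF, -, hclosed⟩ := hfin (Finset.univ.image δ)
  set s : Finset E := (Finset.range n ×ˢ F).image fun p => D^[p.1] (a p.2) with hs
  have hmem : ∀ k < n, ∀ i ∈ F, D^[k] (a i) ∈ s := fun k hk i hi =>
    Finset.mem_image.mpr ⟨(k, i), by simp [hk, hi], rfl⟩
  have hself : ∀ x ∈ s, IsAlgebraic (Algebra.adjoin H (s : Set E)) x := fun x hx =>
    isAlgebraic_algebraMap (⟨x, Algebra.subset_adjoin hx⟩ : Algebra.adjoin H (s : Set E))
  have hle : ∀ k ≤ n, ∀ i ∈ F, IsAlgebraic (Algebra.adjoin H (s : Set E)) (D^[k] (a i)) := by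
    intro k hk i hi
    rcases hk.lt_or_eq with hk | rfl
    · exact hself _ (hmem k hk i hi)
    · refine (han i).tower_top_of_subalgebra_le (Algebra.adjoin_mono ?_)
      rintro _ ⟨l, hl, rfl⟩
      exact hmem l hl i hi
  have hDs : ∀ x ∈ (s : Set E), IsAlgebraic (Algebra.adjoin H (s : Set E)) (D x) := by
    intro x hx
    obtain ⟨⟨k, i⟩, hki, rfl⟩ := Finset.mem_image.mp hx
    obtain ⟨hk, hi⟩ := Finset.mem_product.mp hki
    rw [← Function.iterate_succ_apply' D]
    exact hle (k + 1) (Finset.mem_range.mp hk) i hi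
  have hval := hclosed
    {γ | ∃ x, x ≠ 0 ∧ IsAlgebraic (Algebra.adjoin H (s : Set E)) x ∧ hE.val x = γ}
    (fun a ha b hb hab => hE.psi_sub_mem_val_isAlgebraic hD hDs ha hb hab)
    fun i hi => ⟨a i, (ha₀ _).ne', hle 0 n.zero_le i hi, ha₀γ _⟩
  choose x hx0 hxalg hxval using fun p : Fin (n ^ 2 + 1) × Fin (n + 1) =>
    hval (δ p.1) (Finset.mem_image_of_mem δ (Finset.mem_univ _)) p.2
  have hind : AlgebraicIndependent H x := hE.algebraicIndependent_of_val hx0 fun k hk => by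
    simp only [hxval, Fintype.sum_prod_type] at hk
    ext p
    exact congrFun (congrFun (hδ (fun j l => k (j, l)) hk) p.1) p.2
  have hcard := card_le_of_algebraicIndependent hind hxalg
  have hscard : s.card ≤ n * F.card := by
    simpa using Finset.card_image_le (s := Finset.range n ×ˢ F) (f := fun p => D^[p.1] (a p.2))
  have hδcard : (Finset.univ.image δ).card ≤ n ^ 2 + 1 := by
    simpa using Finset.card_image_le (s := Finset.univ) (f := δ)
  rw [Nat.card_eq_fintype_card, Fintype.card_prod, Fintype.card_fin, Fintype.card_fin] at hcard
  have h1 : n * F.card ≤ n * (n ^ 2 + 1 + n) := Nat.mul_le_mul_left n (by omega)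
  nlinarith

end IsHField

end Independence

/-- **Theorem A.** Let `E` be an H-field with derivation `d`, and `H` a subfield of
`E` closed under `d` which, with the induced ordering and derivation, is a short H-field.  If `E`
is differentially algebraic over `H` (for every `e ∈ E` the family `(e, de, d²e, …)` is
algebraically dependent over `H`) and the constant field of `E` is short, then `E` is short. -/
theorem short_of_differentially_algebraic {E : Type*} [Field E] [LinearOrder E] (d : E → E)
    (hE : IsHField E d)
    (H : Subfield E) (hdH : ∀ x ∈ H, d x ∈ H)
    (hHfield : IsHField H (fun x : H => (⟨d x, hdH x x.2⟩ : H)))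
    (hHshort : IsShort H)
    (hdalg : ∀ e : E, ¬ AlgebraicIndependent H (fun n : ℕ => d^[n] e))
    (hCshort : IsShort {x : E // d x = 0}) :
    IsShort E := by
  have : IsOrderedAddMonoid E :=
    { add_le_add_left := fun a b h c => by
        rw [add_comm a, add_comm b]
        exact hE.add_le_add_left a b h c }
  have : ZeroLEOneClass E := ⟨le_of_not_gt fun h => by
    have h1 : (0 : E) < -1 := neg_pos.mpr h
    have h2 := hE.mul_pos _ _ h1 h1
    rw [neg_mul_neg, one_mul] at h2
    exact lt_asymm h h2⟩
  have : IsStrictOrderedRing E := IsStrictOrderedRing.of_mul_pos hE.mul_pos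
  let D : Derivation ℤ E E :=
    Derivation.mk' (AddMonoidHom.mk' d hE.map_add).toIntLinearMap hE.leibniz
  have hED : IsHField E D := hE
  exact hED.isShort_of_isAlgebraic_iterate hdH hHshort hCshort
    fun e => exists_isAlgebraic_iterate (hdalg e)
end

section
/- Let H be a short Hardy field. Then the subfield H(ℝ) of the ring of germs at +∞ generated by H together with the germs of all real constant functions is again a Hardy field, is linearly ordered by the germ ordering, and is short. -/
open Filter

/-- The ring of germs at `+∞` of real valued functions of one real variable. -/
abbrev GermAtTop : Type := Filter.Germ (Filter.atTop : Filter ℝ) ℝ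

/-- A *Hardy field* is a subring of the ring of germs at `+∞` which is a field (inverses of
nonzero elements exist and lie in it) and such that every element is the germ of a function which
is continuously differentiable on some interval `(a, ∞)`, with the germ of its derivative again
in the subring. -/
structure IsHardyField (H : Subring GermAtTop) : Prop where
  inv_mem : ∀ h ∈ H, h ≠ 0 → ∃ g ∈ H, h * g = 1
  deriv_mem : ∀ h ∈ H, ∃ (f : ℝ → ℝ) (a : ℝ), h = (f : GermAtTop) ∧
    ContDiffOn ℝ 1 f (Set.Ioi a) ∧ ((deriv f : ℝ → ℝ) : GermAtTop) ∈ H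

/-- The subfield `H(ℝ)` of the ring of germs at `+∞` generated by `H` together with the germs of
all real constant functions:  the smallest subring containing `H` and all real constants and
closed under taking multiplicative inverses (whenever they exist in the germ ring). -/
def adjoinConstants (H : Subring GermAtTop) : Subring GermAtTop :=
  sInf {S : Subring GermAtTop | (H : Set GermAtTop) ⊆ ↑S ∧ (∀ c : ℝ, (c : GermAtTop) ∈ S) ∧
    ∀ x ∈ S, ∀ y : GermAtTop, x * y = 1 → y ∈ S}

namespace AsymptoticField

/-- A subset of a preordered set is short if each of its subsets has countable cofinality and
countable coinitiality. -/
def ShortOn {α : Type*} [Preorder α] (S : Set α) : Prop :=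
  ∀ A ⊆ S,
    (∃ B ⊆ A, B.Countable ∧ ∀ x ∈ A, ∃ y ∈ B, x ≤ y) ∧
    (∃ B ⊆ A, B.Countable ∧ ∀ x ∈ A, ∃ y ∈ B, y ≤ x)

open ArchimedeanClass

section LogDeriv

variable {K : Type*} [Field K] {D : Derivation ℤ K K}

lemma logDeriv_mul {f g : K} (hf : f ≠ 0) (hg : g ≠ 0) :
    D (f * g) / (f * g) = D f / f + D g / g := by
  rw [D.leibniz]
  simp only [smul_eq_mul]
  field_simp
  ring

lemma logDeriv_inv {f : K} : D f⁻¹ / f⁻¹ = - (D f / f) := by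
  rcases eq_or_ne f 0 with rfl | hf
  · simp
  have := logDeriv_mul (D := D) hf (inv_ne_zero hf)
  rw [mul_inv_cancel₀ hf] at this
  simp only [Derivation.map_one_eq_zero, zero_div] at this
  linear_combination -this

lemma logDeriv_zpow (f : K) (m : ℤ) : D (f ^ m) / f ^ m = m * (D f / f) := by
  rcases eq_or_ne f 0 with rfl | hf
  · by_cases h : m = 0 <;> simp [h, zero_zpow]
  have := D.leibniz_zpow f m
  rw [this]
  simp only [zsmul_eq_mul, smul_eq_mul]
  rw [zpow_sub_one₀ hf]
  field_simp

end LogDeriv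

variable {K : Type*} [Field K] [LinearOrder K] [IsStrictOrderedRing K]

lemma mk_mul_le_mk_mul_iff_of_ne_zero {a b c : K} (hc : c ≠ 0) :
    mk (c * a) ≤ mk (c * b) ↔ mk a ≤ mk b := by
  simp only [mk_le_mk, abs_mul, nsmul_eq_mul, mul_left_comm _ |c|]
  simp [hc]

lemma mk_mul_lt_mk_mul_iff_of_ne_zero {a b c : K} (hc : c ≠ 0) :
    mk (c * a) < mk (c * b) ↔ mk a < mk b := by
  rw [← not_le, ← not_le, mk_mul_le_mk_mul_iff_of_ne_zero hc]

lemma mk_inv_pos_of_neg {a : K} (ha : mk a < 0) : 0 < mk a⁻¹ := by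
  have h0 : a ≠ 0 := by rintro rfl; simp at ha
  rw [← mk_one, ← mk_mul_lt_mk_mul_iff_of_ne_zero (inv_ne_zero h0), inv_mul_cancel₀ h0, mul_one,
    mk_one] at ha
  exact ha

variable (D : Derivation ℤ K K)

/-- Positive infinitesimals have negative derivative. -/
def NegOnInfinitesimals : Prop := ∀ f : K, 0 < f → 0 < mk f → D f < 0

variable {D}

lemma mk_sub_pos {f g : K} (hf : 0 < mk f) (hg : 0 < mk g) : 0 < mk (f - g) :=
  (lt_min hf hg).trans_le (min_le_mk_sub f g)

lemma NegOnInfinitesimals.le_of_le (hD : NegOnInfinitesimals D) {f g : K} (hf : 0 < mk f)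
    (hg : 0 < mk g) : f ≤ g ↔ D g ≤ D f := by
  rcases lt_trichotomy f g with h | rfl | h
  · have := hD _ (sub_pos.2 h) (mk_sub_pos hg hf)
    rw [map_sub] at this
    exact iff_of_true h.le (by linarith)
  · simp
  · have := hD _ (sub_pos.2 h) (mk_sub_pos hf hg)
    rw [map_sub] at this
    exact iff_of_false (by linarith) (by linarith)

lemma NegOnInfinitesimals.mk_le_mk_iff (hD : NegOnInfinitesimals D) {f g : K} (hf : 0 < mk f)
    (hg : 0 < mk g) : mk (D f) ≤ mk (D g) ↔ mk f ≤ mk g := by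
  have key : ∀ f : K, mk (D |f|) = mk (D f) := fun f ↦ by
    rcases abs_choice f with h | h <;> simp [h]
  rw [← mk_abs f, ← mk_abs g] at *
  rw [← key f, ← key g]
  have hpos := abs_nonneg f
  have hgpos := abs_nonneg g
  generalize |f| = f at *
  generalize |g| = g at *
  rw [mk_le_mk, mk_le_mk]
  refine exists_congr fun n ↦ ?_
  have h0 : 0 < mk (0 : K) := by simp
  have hDf := (hD.le_of_le h0 hf).1 hpos
  have hDg := (hD.le_of_le h0 hg).1 hgpos
  rw [map_zero] at hDf hDg
  rw [abs_of_nonneg hpos, abs_of_nonneg hgpos, abs_of_nonpos hDf, abs_of_nonpos hDg,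
    hD.le_of_le hg, map_nsmul, smul_neg, neg_le_neg_iff]
  rw [nsmul_eq_mul, mk_mul]
  exact hf.trans_le (le_add_of_nonneg_left (mk_natCast_nonneg n))

lemma NegOnInfinitesimals.mk_lt_mk_iff (hD : NegOnInfinitesimals D) {f g : K} (hf : 0 < mk f)
    (hg : 0 < mk g) : mk (D f) < mk (D g) ↔ mk f < mk g := by
  rw [← not_le, ← not_le, hD.mk_le_mk_iff hg hf]

lemma NegOnInfinitesimals.mk_eq_mk (hD : NegOnInfinitesimals D) {f g : K} (hf : 0 < mk f)
    (h : mk f = mk g) : mk (D f) = mk (D g) :=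
  le_antisymm ((hD.mk_le_mk_iff hf (h ▸ hf)).2 h.le) ((hD.mk_le_mk_iff (h ▸ hf) hf).2 h.ge)

lemma NegOnInfinitesimals.ne_zero (hD : NegOnInfinitesimals D) {f : K} (hf : 0 < mk f)
    (h : f ≠ 0) : D f ≠ 0 := by
  intro h'
  have := (hD.mk_le_mk_iff (f := 0) (by simp) hf).1 (by simp [h'])
  simp_all

lemma NegOnInfinitesimals.logDeriv_neg (hD : NegOnInfinitesimals D) {f : K} (hf : 0 < mk f)
    (h : f ≠ 0) : D f / f < 0 := by
  rcases lt_or_gt_of_ne h with h | h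
  · have := hD (-f) (by linarith) (by simpa)
    rw [map_neg] at this
    exact div_neg_of_pos_of_neg (by linarith) h
  · exact div_neg_of_neg_of_pos (hD _ h hf) h

lemma NegOnInfinitesimals.mk_logDeriv_lt_mk (hD : NegOnInfinitesimals D) {f g : K}
    (hf : 0 < mk f) (hf0 : f ≠ 0) (hg : 0 < mk g) : mk (D f / f) < mk (D g) := by
  rw [← mk_mul_lt_mk_mul_iff_of_ne_zero hf0, mul_div_cancel₀ _ hf0]
  have h1 : ∀ {a : K}, a ≠ 0 → mk a < mk (g * a) := fun {a} ha ↦ by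
    rw [mul_comm]
    nth_rw 1 [← mul_one a]
    rwa [mk_mul_lt_mk_mul_iff_of_ne_zero ha]
  have h2 : mk (D f) < mk (D (g * f)) :=
    (hD.mk_lt_mk_iff hf (hf.trans (h1 hf0))).2 (h1 hf0)
  have h3 := h1 (hD.ne_zero hf hf0)
  have h4 : f * D g = D (g * f) - g * D f := by simp
  rw [h4]
  exact (lt_min h2 h3).trans_le (min_le_mk_sub _ _)

section Constants

variable {C : ℝ →+*o K}

lemma NegOnInfinitesimals.mk_logDeriv_lt_of_mk_eq_zero (hD : NegOnInfinitesimals D)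
    (hC : ∀ r, D (C r) = 0) {u g : K} (hu : mk u = 0) (hg : 0 < mk g) (hg0 : g ≠ 0) :
    mk (D g / g) < mk (D u / u) := by
  have h1 := mk_sub_stdPart_pos C hu.ge
  have h2 := hD.mk_logDeriv_lt_mk hg hg0 h1
  rw [map_sub, hC, sub_zero] at h2
  rwa [mk_div (D u) u, hu, sub_zero]

lemma NegOnInfinitesimals.mk_logDeriv_le (hD : NegOnInfinitesimals D)
    (hC : ∀ r, D (C r) = 0) {f g : K} (hg : 0 < mk g) (hf0 : f ≠ 0) (h : mk g ≤ mk f) :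
    mk (D f / f) ≤ mk (D g / g) := by
  have hg0 : g ≠ 0 := by rintro rfl; simp_all
  have hu0 : f / g ≠ 0 := div_ne_zero hf0 hg0
  have hu : 0 ≤ mk (f / g) := by
    rw [← mk_one, ← mk_mul_le_mk_mul_iff_of_ne_zero hg0, mul_one, mul_div_cancel₀ _ hg0]
    exact h
  have h1 := logDeriv_mul (D := D) hg0 hu0
  rw [mul_div_cancel₀ _ hg0] at h1
  rw [h1]
  rcases hu.eq_or_lt with hu | hu
  · rw [mk_add_eq_mk_left]
    exact hD.mk_logDeriv_lt_of_mk_eq_zero hC hu.symm hg hg0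
  · apply mk_le_mk_of_abs
    have h2 := hD.logDeriv_neg hg hg0
    have h3 := hD.logDeriv_neg hu hu0
    rw [abs_of_neg h2, abs_of_neg (by linarith)]
    linarith

variable (D) in
/-- A multiplicatively closed set of elements, saturated with respect to archimedean equivalence
and closed under differentiation of infinitesimals. -/
structure IsValuationClosed (S : Set K) : Prop where
  intro ::
  mul_mem : ∀ {x y}, x ∈ S → y ∈ S → x * y ∈ S
  inv_mem : ∀ {x}, x ∈ S → x⁻¹ ∈ S
  mem_of_mk_eq : ∀ {x y}, x ∈ S → ArchimedeanClass.mk x = ArchimedeanClass.mk y → y ∈ S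
  deriv_mem : ∀ {x}, x ∈ S → 0 < ArchimedeanClass.mk x → D x ∈ S

lemma IsValuationClosed.div_mem {S : Set K} (hS : IsValuationClosed D S) {x y : K}
    (hx : x ∈ S) (hy : y ∈ S) : x / y ∈ S := by
  rw [div_eq_mul_inv]; exact hS.mul_mem hx (hS.inv_mem hy)

lemma IsValuationClosed.logDeriv_mem {S : Set K} (hS : IsValuationClosed D S) {x : K}
    (hx : x ∈ S) (hx0 : mk x ≠ 0) : D x / x ∈ S := by
  rcases hx0.lt_or_gt with h | h
  · have h1 := mk_inv_pos_of_neg h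
    have h2 := hS.div_mem (hS.deriv_mem (hS.inv_mem hx) h1) (hS.inv_mem hx)
    rw [logDeriv_inv] at h2
    exact hS.mem_of_mk_eq h2 (by simp)
  · exact hS.div_mem (hS.deriv_mem hx h) hx

/-- Integration of an infinitesimal whose size is bounded by an infinitesimal of `S`. -/
lemma IsValuationClosed.mem_of_deriv_mem {S : Set K} (hS : IsValuationClosed D S)
    (hD : NegOnInfinitesimals D) (hC : ∀ r, D (C r) = 0) {f k : K} (hk : 0 < mk k) (hkS : k ∈ S)
    (hkf : mk k ≤ mk f) (hf0 : f ≠ 0) (hf : D f ∈ S) : f ∈ S := by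
  have hk0 : k ≠ 0 := by rintro rfl; simp_all
  have hfi := hk.trans_le hkf
  have hDk := hD.ne_zero hk hk0
  have hDf := hD.ne_zero hfi hf0
  have hψ := hD.mk_logDeriv_le hC hk hf0 hkf
  have hlk : D k / k ≠ 0 := div_ne_zero hDk hk0
  have hlf : D f / f ≠ 0 := div_ne_zero hDf hf0
  obtain ⟨w, hw⟩ : ∃ w, w = (D f / f) / (D k / k) := ⟨_, rfl⟩
  have hw0 : w ≠ 0 := hw ▸ div_ne_zero hlf hlk
  have hwf : D k / k * w = D f / f := by rw [hw]; field_simp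
  have hwle : mk w ≤ 0 := by
    rwa [← mk_one, ← mk_mul_le_mk_mul_iff_of_ne_zero hlk, mul_one, hwf]
  have hlw : mk (D f / f) < mk (D w / w) := by
    rcases hwle.eq_or_lt with h | h
    · exact hD.mk_logDeriv_lt_of_mk_eq_zero hC h hfi hf0
    · have hwi := mk_inv_pos_of_neg h
      have h1 := hD.mk_logDeriv_lt_mk hk hk0 hwi
      rw [← mk_mul_lt_mk_mul_iff_of_ne_zero hw0, mul_comm, hwf, mul_comm, ← div_inv_eq_mul,
        logDeriv_inv, mk_neg] at h1
      exact h1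
  have hg0 : f * w ≠ 0 := mul_ne_zero hf0 hw0
  have hgS : f * w ∈ S := by
    have : f * w = D f / (D k / k) := by rw [hw]; field_simp
    rw [this]
    exact hS.div_mem hf (hS.logDeriv_mem hkS hk.ne')
  have hlg : mk (D (f * w) / (f * w)) = mk (D f / f) := by
    rw [logDeriv_mul hf0 hw0, mk_add_eq_mk_left hlw]
  have hg1 : mk (f * w) ≠ 0 := fun h ↦
    (hD.mk_logDeriv_lt_of_mk_eq_zero hC h hfi hf0).ne hlg.symm
  refine hS.mem_of_mk_eq (hS.div_mem hf (hS.logDeriv_mem hgS hg1)) ?_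
  rw [mk_div, hlg, ← mk_div]
  congr 1
  field_simp

end Constants
open ArchimedeanClass

variable {K : Type*} [Field K] [LinearOrder K] [IsStrictOrderedRing K] {D : Derivation ℤ K K}
  {C : ℝ →+*o K}

variable (D) in
/-- Closure under antiderivatives among infinitesimals. -/
def IsIntegrationClosed (S : Set K) : Prop := ∀ f : K, 0 < mk f → D f ∈ S → f ∈ S

/-- The elements archimedean equivalent to `h * e ^ m` for some `h` in `H` and `m : ℤ`. -/
def monomialHull (H : Subfield K) (e : K) : Set K :=
  {x | ∃ h ∈ H, ∃ m : ℤ, mk x = mk (h * e ^ m)}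

lemma mem_monomialHull_of_mem {H : Subfield K} (e : K) {h : K} (hh : h ∈ H) :
    h ∈ monomialHull H e := ⟨h, hh, 0, by simp⟩

lemma mem_monomialHull_one {H : Subfield K} {x : K} :
    x ∈ monomialHull H 1 ↔ ∃ h ∈ H, mk x = mk h := by
  simp [monomialHull]

lemma monomialHull_one_subset (H : Subfield K) (e : K) : monomialHull H 1 ⊆ monomialHull H e := by
  intro x hx
  obtain ⟨h, hh, hx⟩ := mem_monomialHull_one.1 hx
  exact ⟨h, hh, 0, by simpa using hx⟩

lemma mul_mem_monomialHull {H : Subfield K} {e x y : K} (he : e ≠ 0) (hx : x ∈ monomialHull H e)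
    (hy : y ∈ monomialHull H e) : x * y ∈ monomialHull H e := by
  obtain ⟨h, hh, m, hx⟩ := hx
  obtain ⟨k, hk, n, hy⟩ := hy
  refine ⟨h * k, H.mul_mem hh hk, m + n, ?_⟩
  rw [mk_mul, hx, hy, ← mk_mul, zpow_add₀ he, mul_mul_mul_comm]

lemma isValuationClosed_monomialHull {H : Subfield K} {e : K} (he : e ≠ 0)
    (hder : ∀ x ∈ monomialHull H e, 0 < mk x → D x ∈ monomialHull H e) :
    IsValuationClosed D (monomialHull H e) where
  mul_mem := mul_mem_monomialHull he
  inv_mem := by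
    rintro x ⟨h, hh, m, hx⟩
    refine ⟨h⁻¹, H.inv_mem hh, -m, ?_⟩
    rw [mk_inv, hx, ← mk_inv, mul_inv, zpow_neg]
  mem_of_mk_eq := by
    rintro x y ⟨h, hh, m, hx⟩ hxy
    exact ⟨h, hh, m, hxy ▸ hx⟩
  deriv_mem := fun hx h ↦ hder _ hx h

lemma isValuationClosed_monomialHull_one {H : Subfield K} (hD : NegOnInfinitesimals D)
    (hH : ∀ h ∈ H, D h ∈ H) : IsValuationClosed D (monomialHull H 1) := by
  refine isValuationClosed_monomialHull one_ne_zero fun x hx hx0 ↦ ?_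
  obtain ⟨h, hh, hx⟩ := mem_monomialHull_one.1 hx
  exact mem_monomialHull_one.2 ⟨D h, hH h hh, hD.mk_eq_mk hx0 hx⟩

section Gap

variable {H : Subfield K} {e : K}

lemma mk_lt_mk_of_notMem (hD : NegOnInfinitesimals D) (hC : ∀ r, D (C r) = 0)
    (hH : ∀ h ∈ H, D h ∈ H) (he : 0 < mk e) (hDe : D e ∈ monomialHull H 1)
    (heH : e ∉ monomialHull H 1) {h : K} (hh : h ∈ H) (hh0 : 0 < mk h) : mk e < mk h := by
  by_contra! hle
  have hS := isValuationClosed_monomialHull_one hD hH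
  have he0 : e ≠ 0 := by
    rintro rfl
    exact heH (mem_monomialHull_of_mem _ H.zero_mem)
  exact heH (hS.mem_of_deriv_mem hD hC hh0 (mem_monomialHull_of_mem _ hh) hle he0 hDe)

lemma mk_logDeriv_lt_of_notMem (hD : NegOnInfinitesimals D) (hC : ∀ r, D (C r) = 0)
    (hH : ∀ h ∈ H, D h ∈ H) (he : 0 < mk e) (hDe : D e ∈ monomialHull H 1)
    (heH : e ∉ monomialHull H 1) {h : K} (hh : h ∈ H) (hh0 : h ≠ 0) (hh1 : mk h ≠ 0) :
    mk (D h / h) < mk (D e / e) := by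
  have he0 : e ≠ 0 := by
    rintro rfl
    exact heH (mem_monomialHull_of_mem _ H.zero_mem)
  wlog hpos : 0 < mk h generalizing h
  · have h1 := this (H.inv_mem hh) (inv_ne_zero hh0) (by simpa using hh1)
      (mk_inv_pos_of_neg (lt_of_le_of_ne (not_lt.1 hpos) hh1))
    rwa [logDeriv_inv, mk_neg] at h1
  have hS := isValuationClosed_monomialHull_one hD hH
  have h1 := mk_lt_mk_of_notMem hD hC hH he hDe heH hh hpos
  refine (hD.mk_logDeriv_le hC he hh0 h1.le).lt_of_ne fun h2 ↦ heH ?_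
  have hDe0 := hD.ne_zero he he0
  refine hS.mem_of_mk_eq (hS.div_mem hDe
    (hS.logDeriv_mem (mem_monomialHull_of_mem _ hh) hpos.ne')) ?_
  rw [mk_div, h2, ← mk_div]
  congr 1
  field_simp

lemma mk_zpow_lt_mk_of_notMem (hD : NegOnInfinitesimals D) (hC : ∀ r, D (C r) = 0)
    (hH : ∀ h ∈ H, D h ∈ H) (he : 0 < mk e) (hDe : D e ∈ monomialHull H 1)
    (heH : e ∉ monomialHull H 1) {h : K} (hh : h ∈ H) (hh1 : 0 < mk h) (m : ℤ) :
    mk (e ^ m) < mk h := by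
  have he0 : e ≠ 0 := by
    rintro rfl
    exact heH (mem_monomialHull_of_mem _ H.zero_mem)
  have hem : e ^ m ≠ 0 := zpow_ne_zero _ he0
  rcases eq_or_ne h 0 with rfl | hh0
  · rw [mk_zero]
    exact lt_top_iff_ne_top.2 (mk_eq_top_iff.not.2 hem)
  by_contra! hle
  have h1 := hD.mk_logDeriv_le hC hh1 hem hle
  rw [logDeriv_zpow, mk_mul] at h1
  have h2 := mk_logDeriv_lt_of_notMem hD hC hH he hDe heH hh hh0 hh1.ne'
  exact absurd (h2.trans_le (le_add_of_nonneg_left (mk_intCast_nonneg m))) h1.not_gt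

lemma isValuationClosed_monomialHull_of_notMem (hD : NegOnInfinitesimals D)
    (hC : ∀ r, D (C r) = 0) (hH : ∀ h ∈ H, D h ∈ H) (he : 0 < mk e)
    (hDe : D e ∈ monomialHull H 1) (heH : e ∉ monomialHull H 1) :
    IsValuationClosed D (monomialHull H e) := by
  have he0 : e ≠ 0 := by
    rintro rfl
    exact heH (mem_monomialHull_of_mem _ H.zero_mem)
  have hDe0 := hD.ne_zero he he0
  refine isValuationClosed_monomialHull he0 fun x hx hx0 ↦ ?_
  obtain ⟨h, hh, m, hx⟩ := hx
  have key : D (h * e ^ m) ∈ monomialHull H e := by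
    rcases eq_or_ne h 0 with rfl | hh0
    · simpa using mem_monomialHull_of_mem _ H.zero_mem
    have hem : e ^ m ≠ 0 := zpow_ne_zero _ he0
    have hy0 : h * e ^ m ≠ 0 := mul_ne_zero hh0 hem
    suffices D (h * e ^ m) / (h * e ^ m) ∈ monomialHull H e by
      rw [← div_mul_cancel₀ (D (h * e ^ m)) hy0]
      exact mul_mem_monomialHull he0 this ⟨h, hh, m, rfl⟩
    rw [logDeriv_mul hh0 hem, logDeriv_zpow]
    by_cases hh1 : mk h = 0
    · have hm : m ≠ 0 := by
        rintro rfl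
        rw [hx] at hx0
        simp [hh1] at hx0
      have h1 := hD.mk_logDeriv_lt_of_mk_eq_zero hC hh1 he he0
      have h2 : mk (m * (D e / e)) = mk (D e / e) := by simp [mk_intCast hm]
      obtain ⟨k, hk, hke⟩ := mem_monomialHull_one.1 hDe
      refine ⟨k, hk, -1, ?_⟩
      rw [mk_add_eq_mk_right (h2 ▸ h1), h2, mk_div, hke, ← mk_div, zpow_neg_one, div_eq_mul_inv]
    · have h1 := mk_logDeriv_lt_of_notMem hD hC hH he hDe heH hh hh0 hh1
      refine ⟨D h / h, H.div_mem (hH h hh) hh, 0, ?_⟩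
      rw [zpow_zero, mul_one, mk_add_eq_mk_left]
      rw [mk_mul]
      exact h1.trans_le (le_add_of_nonneg_left (mk_intCast_nonneg m))
  obtain ⟨k, hk, n, hkn⟩ := key
  exact ⟨k, hk, n, (hD.mk_eq_mk hx0 hx).trans hkn⟩

lemma isIntegrationClosed_monomialHull_of_notMem (hD : NegOnInfinitesimals D)
    (hC : ∀ r, D (C r) = 0) (hH : ∀ h ∈ H, D h ∈ H) (he : 0 < mk e)
    (hDe : D e ∈ monomialHull H 1) (heH : e ∉ monomialHull H 1) :
    IsIntegrationClosed D (monomialHull H e) := by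
  have hS := isValuationClosed_monomialHull_of_notMem hD hC hH he hDe heH
  have he0 : e ≠ 0 := by
    rintro rfl
    exact heH (mem_monomialHull_of_mem _ H.zero_mem)
  have heS : e ∈ monomialHull H e := ⟨1, H.one_mem, 1, by simp⟩
  intro f hf hDf
  rcases eq_or_ne f 0 with rfl | hf0
  · exact mem_monomialHull_of_mem _ H.zero_mem
  rcases le_or_gt (mk e) (mk f) with hef | hfe
  · exact hS.mem_of_deriv_mem hD hC he heS hef hf0 hDf
  exfalso
  have hDe0 := hD.ne_zero he he0
  have h1 : mk (D f / D e) < mk 1 := by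
    rw [← mk_mul_lt_mk_mul_iff_of_ne_zero hDe0, mul_one, mul_div_cancel₀ _ hDe0]
    exact (hD.mk_lt_mk_iff hf he).2 hfe
  have h2 : mk e⁻¹ < mk (D f / D e) := by
    rw [← mk_mul_lt_mk_mul_iff_of_ne_zero hDe0, mul_div_cancel₀ _ hDe0, ← div_eq_mul_inv]
    exact hD.mk_logDeriv_lt_mk he he0 hf
  obtain ⟨h, hh, m, hm⟩ := hS.div_mem hDf (monomialHull_one_subset H e hDe)
  rw [hm] at h1 h2
  have hem : e ^ m ≠ 0 := zpow_ne_zero _ he0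
  have hh0 : h ≠ 0 := by
    rintro rfl
    simp [mk_one] at h1
  have hz := fun {k : K} ↦ @mk_zpow_lt_mk_of_notMem K _ _ _ D C H e hD hC hH he hDe heH k
  rcases lt_trichotomy (mk h) 0 with h3 | h3 | h3
  · have h4 := hz (H.inv_mem hh) (mk_inv_pos_of_neg h3) (m + 1)
    rw [← mk_mul_lt_mk_mul_iff_of_ne_zero (mul_ne_zero hh0 (inv_ne_zero he0))] at h4
    have h5 : h * e⁻¹ * e ^ (m + 1) = h * e ^ m := by
      rw [zpow_add_one₀ he0]
      field_simp
    have h6 : h * e⁻¹ * h⁻¹ = e⁻¹ := by field_simp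
    rw [h5, h6] at h4
    exact h4.not_gt h2
  · rw [mk_mul, h3, zero_add, mk_one] at h1
    rw [mk_mul, h3, zero_add] at h2
    rcases lt_or_ge m 0 with h4 | h4
    · refine h2.not_ge ?_
      obtain ⟨n, rfl⟩ : ∃ n : ℕ, m = - (n + 1 : ℕ) := ⟨(-m - 1).toNat, by omega⟩
      rw [← mk_mul_le_mk_mul_iff_of_ne_zero (pow_ne_zero (n + 1) he0), zpow_neg, zpow_natCast,
        mul_inv_cancel₀ (pow_ne_zero _ he0), pow_succ, mul_inv_cancel_right₀ he0, mk_one, mk_pow]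
      exact nsmul_nonneg he.le n
    · lift m to ℕ using h4
      rw [zpow_natCast, mk_pow] at h1
      exact h1.not_ge (nsmul_nonneg he.le m)
  · have h4 := hz hh h3 (-m)
    rw [← mk_mul_lt_mk_mul_iff_of_ne_zero hem, zpow_neg, mul_inv_cancel₀ hem, mul_comm] at h4
    exact h4.not_gt h1

end Gap

lemma exists_isIntegrationClosed_monomialHull {H : Subfield K} (hD : NegOnInfinitesimals D)
    (hC : ∀ r, D (C r) = 0) (hH : ∀ h ∈ H, D h ∈ H) :
    ∃ e, IsValuationClosed D (monomialHull H e) ∧ IsIntegrationClosed D (monomialHull H e) := by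
  by_cases h : IsIntegrationClosed D (monomialHull H 1)
  · exact ⟨1, isValuationClosed_monomialHull_one hD hH, h⟩
  · simp only [IsIntegrationClosed, not_forall] at h
    obtain ⟨e, he, hDe, heH⟩ := h
    exact ⟨e, isValuationClosed_monomialHull_of_notMem hD hC hH he hDe heH,
      isIntegrationClosed_monomialHull_of_notMem hD hC hH he hDe heH⟩

section Combinations

variable {A : Type*} [CommRing A]

/-- The value `∑ C c * h` of a formal linear combination with constant coefficients. -/
def combSum (C : ℝ →+* A) (s : Multiset (ℝ × A)) : A := (s.map fun p ↦ C p.1 * p.2).sum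

lemma combSum_cons (C : ℝ →+* A) (p : ℝ × A) (s : Multiset (ℝ × A)) :
    combSum C (p ::ₘ s) = C p.1 * p.2 + combSum C s := by simp [combSum]

lemma combSum_map_mul (C : ℝ →+* A) (a : A) (s : Multiset (ℝ × A)) :
    combSum C (s.map fun p ↦ (p.1, a * p.2)) = a * combSum C s := by
  induction s using Multiset.induction with
  | empty => simp [combSum]
  | cons p s ih => rw [Multiset.map_cons, combSum_cons, combSum_cons, ih]; ring

lemma exists_combSum_of_mem_closure (C : ℝ →+* A) (H : Subring A) {x : A}
    (hx : x ∈ Subring.closure ((H : Set A) ∪ Set.range C)) :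
    ∃ s : Multiset (ℝ × A), (∀ p ∈ s, p.2 ∈ H) ∧ combSum C s = x := by
  rw [Subring.mem_closure_iff] at hx
  have hcl : Submonoid.closure ((H : Set A) ∪ Set.range C) =
      H.toSubmonoid ⊔ MonoidHom.mrange (C : ℝ →* A) := by
    rw [Submonoid.closure_union]
    congr 1
    · exact H.toSubmonoid.closure_eq
    · exact (MonoidHom.mrange (C : ℝ →* A)).closure_eq
  rw [hcl] at hx
  induction hx using AddSubgroup.closure_induction with
  | mem x hx =>
    obtain ⟨h, hh, _, ⟨c, rfl⟩, rfl⟩ := Submonoid.mem_sup.1 hx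
    exact ⟨{(c, h)}, by simpa using hh, by simp [combSum, mul_comm]⟩
  | zero => exact ⟨0, by simp, by simp [combSum]⟩
  | add x y _ _ hx hy =>
    obtain ⟨s, hs, rfl⟩ := hx
    obtain ⟨t, ht, rfl⟩ := hy
    refine ⟨s + t, fun p hp ↦ ?_, by simp [combSum]⟩
    rcases Multiset.mem_add.1 hp with hp | hp
    exacts [hs p hp, ht p hp]
  | neg x _ hx =>
    obtain ⟨s, hs, rfl⟩ := hx
    refine ⟨s.map fun p ↦ (p.1, -1 * p.2), ?_, by rw [combSum_map_mul, neg_one_mul]⟩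
    simp only [Multiset.mem_map]
    rintro _ ⟨p, hp, rfl⟩
    simpa using hs p hp

lemma deriv_combSum {D : Derivation ℤ A A} {C : ℝ →+* A} (hC : ∀ r, D (C r) = 0)
    (s : Multiset (ℝ × A)) :
    D (combSum C s) = combSum C (s.map fun p ↦ (p.1, D p.2)) := by
  induction s using Multiset.induction with
  | empty => simp [combSum]
  | cons p s ih => simp [combSum_cons, ih, hC]

end Combinations

section

open ArchimedeanClass

variable {K : Type*} [Field K] [LinearOrder K] [IsStrictOrderedRing K] {D : Derivation ℤ K K}
  {C : ℝ →+*o K}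

lemma combSum_mem (hC : ∀ r, D (C r) = 0) {H : Subfield K} (hH : ∀ h ∈ H, D h ∈ H) {S : Set K}
    (hHS : (H : Set K) ⊆ S) (hS : IsValuationClosed D S) (hI : IsIntegrationClosed D S) (n : ℕ) :
    ∀ s : Multiset (ℝ × K), s.card = n → (∀ p ∈ s, p.2 ∈ H) → combSum (C : ℝ →+* K) s ∈ S := by
  classical
  induction n with
  | zero =>
    intro s hs _
    rw [Multiset.card_eq_zero.1 hs]
    simpa [combSum] using hHS H.zero_mem
  | succ n ih =>
    intro s hn hs
    obtain ⟨a, has, ha⟩ := s.toFinset.exists_min_image (fun p ↦ mk p.2)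
      (Multiset.toFinset_nonempty.2 (by rintro rfl; simp at hn))
    rw [Multiset.mem_toFinset] at has
    simp only [Multiset.mem_toFinset] at ha
    rcases eq_or_ne a.2 0 with h0 | h0
    · convert hHS H.zero_mem
      refine Multiset.sum_eq_zero fun x hx ↦ ?_
      obtain ⟨p, hp, rfl⟩ := Multiset.mem_map.1 hx
      have := ha p hp
      simp only [h0, mk_zero, top_le_iff, mk_eq_top_iff] at this
      simp [this]
    have hF : 0 ≤ mk (a.2⁻¹ * combSum (C : ℝ →+* K) s) := by
      rw [← mk_one, ← mk_mul_le_mk_mul_iff_of_ne_zero h0, mul_inv_cancel_left₀ h0, mul_one]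
      clear hn hs has
      induction s using Multiset.induction with
      | empty => simp [combSum]
      | cons p s ihs =>
        rw [combSum_cons]
        refine (le_min ?_ (ihs fun q hq ↦ ha q (Multiset.mem_cons_of_mem hq))).trans
          (min_le_mk_add _ _)
        rw [mk_mul]
        exact (ha p (Multiset.mem_cons_self _ _)).trans
          (le_add_of_nonneg_left (mk_map_nonneg_of_archimedean C p.1))
    obtain ⟨F, hFdef⟩ : ∃ F, F = a.2⁻¹ * combSum (C : ℝ →+* K) s := ⟨_, rfl⟩
    rw [← hFdef] at hF
    have hsF : combSum (C : ℝ →+* K) s = a.2 * F := by rw [hFdef, mul_inv_cancel_left₀ h0]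
    have hDF : D F ∈ S := by
      obtain ⟨t, rfl⟩ := Multiset.exists_cons_of_mem has
      rw [hFdef, ← combSum_map_mul, Multiset.map_cons, combSum_cons, map_add]
      simp only [inv_mul_cancel₀ h0, mul_one]
      rw [show D ((C : ℝ →+* K) a.1) = 0 from hC a.1, zero_add,
        deriv_combSum (C := (C : ℝ →+* K)) hC]
      refine ih _ (by simpa using hn) ?_
      simp only [Multiset.mem_map]
      rintro _ ⟨_, ⟨p, hp, rfl⟩, rfl⟩
      exact hH _ (H.mul_mem (H.inv_mem (hs a has)) (hs p (Multiset.mem_cons_of_mem hp)))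
    rw [hsF]
    refine hS.mul_mem (hHS (hs a has)) ?_
    have h1 := mk_sub_stdPart_pos C hF
    by_cases hr : stdPart F = 0
    · rw [hr, map_zero, sub_zero] at h1
      exact hI F h1 hDF
    · refine hS.mem_of_mk_eq (hHS H.one_mem) ?_
      rw [mk_one]
      by_contra h
      exact hr (stdPart_eq_zero.2 (Ne.symm h))

/-- The archimedean classes of a field generated by constants over a differential subfield all come
from that subfield, up to integral powers of a single element. -/
lemma exists_monomialHull_eq_univ (hD : NegOnInfinitesimals D) (hC : ∀ r, D (C r) = 0)
    {H : Subfield K} (hH : ∀ h ∈ H, D h ∈ H)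
    (hK : Subfield.closure ((H : Set K) ∪ Set.range C) = ⊤) :
    ∃ e, monomialHull H e = Set.univ := by
  obtain ⟨e, hS, hI⟩ := exists_isIntegrationClosed_monomialHull hD hC hH
  refine ⟨e, Set.eq_univ_of_forall fun x ↦ ?_⟩
  have hx : x ∈ Subfield.closure ((H : Set K) ∪ Set.range C) := hK ▸ Subfield.mem_top x
  obtain ⟨y, hy, z, hz, rfl⟩ := Subfield.mem_closure_iff.1 hx
  have key : ∀ y ∈ Subring.closure ((H : Set K) ∪ Set.range C), y ∈ monomialHull H e := by
    intro y hy
    obtain ⟨s, hs, rfl⟩ := exists_combSum_of_mem_closure (C : ℝ →+* K) H.toSubring hy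
    exact combSum_mem hC hH (fun h hh ↦ mem_monomialHull_of_mem e hh) hS hI _ s rfl hs
  exact hS.div_mem (key y hy) (key z hz)

end

section Short

lemma ShortOn.mono {α : Type*} [Preorder α] {S T : Set α} (hT : ShortOn T) (h : S ⊆ T) :
    ShortOn S := fun A hA ↦ hT A (hA.trans h)

lemma ShortOn.iUnion {α ι : Type*} [Preorder α] [Countable ι] {S : ι → Set α}
    (hS : ∀ i, ShortOn (S i)) : ShortOn (⋃ i, S i) := by
  intro A hA
  have h := fun i ↦ hS i (A ∩ S i) Set.inter_subset_right
  choose B hBA hB hcof using fun i ↦ (h i).1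
  choose B' hBA' hB' hcoi using fun i ↦ (h i).2
  constructor
  · refine ⟨⋃ i, B i, Set.iUnion_subset fun i ↦ (hBA i).trans Set.inter_subset_left,
      Set.countable_iUnion hB, fun x hx ↦ ?_⟩
    obtain ⟨i, hi⟩ := Set.mem_iUnion.1 (hA hx)
    obtain ⟨y, hy, hxy⟩ := hcof i x ⟨hx, hi⟩
    exact ⟨y, Set.mem_iUnion.2 ⟨i, hy⟩, hxy⟩
  · refine ⟨⋃ i, B' i, Set.iUnion_subset fun i ↦ (hBA' i).trans Set.inter_subset_left,
      Set.countable_iUnion hB', fun x hx ↦ ?_⟩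
    obtain ⟨i, hi⟩ := Set.mem_iUnion.1 (hA hx)
    obtain ⟨y, hy, hxy⟩ := hcoi i x ⟨hx, hi⟩
    exact ⟨y, Set.mem_iUnion.2 ⟨i, hy⟩, hxy⟩

lemma ShortOn.image_of_antitoneOn {α β : Type*} [Preorder α] [Preorder β] {S : Set α}
    (hS : ShortOn S) {f : α → β} (hf : AntitoneOn f S) : ShortOn (f '' S) := by
  intro A hA
  obtain ⟨⟨B, hBA, hB, hcof⟩, ⟨B', hBA', hB', hcoi⟩⟩ := hS (S ∩ f ⁻¹' A) Set.inter_subset_left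
  constructor
  · refine ⟨f '' B', Set.image_subset_iff.2 fun x hx ↦ (hBA' hx).2, hB'.image f, fun y hy ↦ ?_⟩
    obtain ⟨x, hx, rfl⟩ := hA hy
    obtain ⟨z, hz, hzx⟩ := hcoi x ⟨hx, hy⟩
    exact ⟨f z, ⟨z, hz, rfl⟩, hf (hBA' hz).1 hx hzx⟩
  · refine ⟨f '' B, Set.image_subset_iff.2 fun x hx ↦ (hBA hx).2, hB.image f, fun y hy ↦ ?_⟩
    obtain ⟨x, hx, rfl⟩ := hA hy
    obtain ⟨z, hz, hzx⟩ := hcof x ⟨hx, hy⟩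
    exact ⟨f z, ⟨z, hz, rfl⟩, hf hx (hBA hz).1 hzx⟩

open ArchimedeanClass

variable {K : Type*} [Field K] [LinearOrder K] [IsStrictOrderedRing K]

lemma shortOn_univ_archimedeanClass {H : Subfield K} (hH : ShortOn (H : Set K)) {e : K}
    (he : monomialHull H e = Set.univ) : ShortOn (Set.univ : Set (ArchimedeanClass K)) := by
  refine (ShortOn.iUnion (ι := ℤ) (S := fun m ↦
    (fun h ↦ mk (h * e ^ m)) '' ((H : Set K) ∩ Set.Ici 0)) fun m ↦ ?_).mono ?_
  · refine (hH.mono Set.inter_subset_left).image_of_antitoneOn ?_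
    intro x hx y hy hxy
    refine mk_le_mk_of_abs ?_
    rw [abs_mul, abs_mul, abs_of_nonneg hx.2, abs_of_nonneg hy.2]
    gcongr
  · intro γ _
    obtain ⟨x, rfl⟩ := mk_surjective K γ
    have hx : x ∈ monomialHull H e := he ▸ Set.mem_univ x
    obtain ⟨h, hh, m, hx⟩ := hx
    refine Set.mem_iUnion.2 ⟨m, |h|, ⟨?_, abs_nonneg h⟩, ?_⟩
    · rcases abs_choice h with h' | h' <;> rw [h']
      exacts [hh, H.neg_mem hh]
    · simp only [mk_mul, mk_abs, hx]

lemma exists_countable_cofinal (C : ℝ →+*o K)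
    (hv : ShortOn (Set.univ : Set (ArchimedeanClass K))) (A : Set K) :
    ∃ B ⊆ A, B.Countable ∧ ∀ x ∈ A, ∃ y ∈ B, x ≤ y := by
  by_contra! hA
  let I : Set (ArchimedeanClass K) := {γ | ∃ a ∈ A, ∀ b ∈ A, a ≤ b → γ < mk (b - a)}
  obtain ⟨B, hBI, hB, hcof⟩ := (hv I (Set.subset_univ _)).1
  choose! a haA ha using hBI
  obtain ⟨a₀, ha₀A, ha₀⟩ := hA (a '' B) (Set.image_subset_iff.2 haA) (hB.image a)
  have hI : ∀ γ ∈ I, ∀ b ∈ A, a₀ ≤ b → γ < mk (b - a₀) := by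
    intro γ hγ b hb hab
    obtain ⟨γ', hγ', hle⟩ := hcof γ hγ
    have h1 := ha₀ _ ⟨γ', hγ', rfl⟩
    refine hle.trans_lt ((ha hγ' b hb (h1.le.trans hab)).trans_le (mk_le_mk_of_abs ?_))
    rw [abs_of_nonneg (by linarith), abs_of_nonneg (by linarith)]
    linarith
  obtain ⟨T, hT, hTc, hcoi⟩ := (hv ((fun b ↦ mk (b - a₀)) '' (A ∩ Set.Ioi a₀))
    (Set.subset_univ _)).2
  have hT' : ∀ t ∈ T, ∃ b, b ∈ A ∧ a₀ < b ∧ mk (b - a₀) = t := fun t ht ↦ by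
    obtain ⟨b, hb, hbt⟩ := hT ht
    exact ⟨b, hb.1, hb.2, hbt⟩
  choose! b hbA hab hbT using hT'
  obtain ⟨b₀, hb₀A, hb₀⟩ := hA (insert a₀ (b '' T))
    (Set.insert_subset ha₀A (Set.image_subset_iff.2 fun t ht ↦ hbA t ht))
    ((hTc.image b).insert a₀)
  have hab₀ : a₀ < b₀ := hb₀ _ (Set.mem_insert _ _)
  have hd : 0 < b₀ - a₀ := sub_pos.2 hab₀
  have hmin : ∀ x ∈ A, a₀ < x → mk (b₀ - a₀) ≤ mk (x - a₀) := by
    intro x hx hax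
    obtain ⟨t, ht, htx⟩ := hcoi _ ⟨x, ⟨hx, hax⟩, rfl⟩
    refine le_trans ?_ htx
    rw [← hbT t ht]
    have h1 : a₀ < b t := hab t ht
    have h2 := hb₀ (b t) (Set.mem_insert_of_mem _ ⟨t, ht, rfl⟩)
    refine mk_le_mk_of_abs ?_
    rw [abs_of_nonneg (by linarith), abs_of_nonneg (by linarith)]
    linarith
  have hq : ∀ q : ℚ, ∃ c ∈ A, ∀ x ∈ A, C q * (b₀ - a₀) < x - a₀ → C q * (b₀ - a₀) < c - a₀ := by
    intro q
    by_cases h : ∃ x ∈ A, C q * (b₀ - a₀) < x - a₀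
    · obtain ⟨x, hx, h⟩ := h
      exact ⟨x, hx, fun _ _ _ ↦ h⟩
    · push Not at h
      exact ⟨b₀, hb₀A, fun x hx h' ↦ absurd h' (h x hx).not_gt⟩
  choose c hcA hc using hq
  obtain ⟨b₁, hb₁A, hb₁⟩ := hA (insert b₀ (Set.range c))
    (Set.insert_subset hb₀A (Set.range_subset_iff.2 hcA)) ((Set.countable_range c).insert b₀)
  have hb₀₁ : b₀ < b₁ := hb₁ _ (Set.mem_insert _ _)
  have hmem : mk (b₀ - a₀) ∈ I := by
    refine ⟨b₁, hb₁A, fun x hx hbx ↦ ?_⟩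
    by_contra! hle
    obtain ⟨n, hn⟩ := mk_le_mk.1 hle
    rw [abs_of_pos hd, abs_of_nonneg (by linarith), nsmul_eq_mul] at hn
    have hn0 : 0 < (n : ℝ) := by
      rcases Nat.eq_zero_or_pos n with rfl | h
      · simp at hn; linarith
      · exact_mod_cast h
    have hfin : ∀ x ∈ A, b₁ ≤ x → 0 ≤ mk ((x - a₀) / (b₀ - a₀)) := by
      intro x hx hbx
      rw [← mk_one, ← mk_mul_le_mk_mul_iff_of_ne_zero hd.ne', mul_one,
        mul_div_cancel₀ _ hd.ne']
      exact hmin x hx (by linarith)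
    have hr₁ := hfin b₁ hb₁A le_rfl
    have hr₂ := hfin x hx hbx
    have hlt : stdPart ((b₁ - a₀) / (b₀ - a₀)) + 1 / n ≤ stdPart ((x - a₀) / (b₀ - a₀)) := by
      have hsum : (b₁ - a₀) / (b₀ - a₀) + C (1 / n : ℝ) ≤ (x - a₀) / (b₀ - a₀) := by
        rw [← sub_nonneg]
        have hn' : (0 : K) < n := by exact_mod_cast hn0
        have : (x - a₀) / (b₀ - a₀) - ((b₁ - a₀) / (b₀ - a₀) + C (1 / n : ℝ)) =
            (n * (x - b₁) - (b₀ - a₀)) / (n * (b₀ - a₀)) := by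
          rw [map_div₀, map_one, map_natCast]
          have := hd.ne'
          field_simp
          ring
        rw [this]
        exact div_nonneg (by linarith) (by positivity)
      have h1 : 0 ≤ mk (C (1 / n : ℝ)) := mk_map_nonneg_of_archimedean C _
      have h2 := stdPart_monotoneOn ((le_min hr₁ h1).trans (min_le_mk_add _ _)) hr₂ hsum
      rwa [stdPart_add hr₁ h1, stdPart_map_real] at h2
    obtain ⟨q, hq₁, hq₂⟩ := exists_rat_btwn
      ((lt_add_of_pos_right _ (one_div_pos.2 hn0)).trans_le hlt)
    have h1 := hc q x hx ((lt_div_iff₀ hd).1 (lt_of_lt_stdPart C hr₂ hq₂))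
    have h2 := hb₁ (c q) (Set.mem_insert_of_mem _ ⟨q, rfl⟩)
    have h3 : C q ≤ (b₁ - a₀) / (b₀ - a₀) := (le_div_iff₀ hd).2 (by linarith)
    exact hq₁.not_ge (le_stdPart_of_le C hr₁ h3)
  exact (hI _ hmem b₀ hb₀A hab₀.le).false

theorem isShort_of_closure_eq_top {D : Derivation ℤ K K} {C : ℝ →+*o K}
    (hD : NegOnInfinitesimals D) (hC : ∀ r, D (C r) = 0) {H : Subfield K}
    (hH : ∀ h ∈ H, D h ∈ H) (hK : Subfield.closure ((H : Set K) ∪ Set.range C) = ⊤)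
    (hshort : ShortOn (H : Set K)) : IsShort K := by
  obtain ⟨e, he⟩ := exists_monomialHull_eq_univ hD hC hH hK
  have hv := shortOn_univ_archimedeanClass hshort he
  intro A
  refine ⟨exists_countable_cofinal C hv A, ?_⟩
  obtain ⟨B, hBA, hB, hcof⟩ := exists_countable_cofinal C hv (-A)
  refine ⟨-B, fun x hx ↦ by simpa using hBA hx, ?_, fun x hx ↦ ?_⟩
  · rw [← Set.image_neg_eq_neg]
    exact hB.image _
  · obtain ⟨y, hy, hxy⟩ := hcof (-x) (by simpa using hx)
    exact ⟨-y, by simpa using hy, by linarith⟩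

end Short

section Germs

/-- The embedding of the real numbers into the ring of germs as constants. -/
def constHom : ℝ →+* GermAtTop := (Germ.coeRingHom atTop).comp (Pi.constRingHom ℝ ℝ)

/-- A germ is eventually positive. -/
def EvPos (x : GermAtTop) : Prop := x.LiftPred (0 < ·)

/-- A germ has an eventually constant sign. -/
def HasSign (x : GermAtTop) : Prop := x = 0 ∨ EvPos x ∨ EvPos (-x)

/-- The germ `y` is the derivative of the continuously differentiable germ `x`. -/
def GermDeriv (x y : GermAtTop) : Prop :=
  ∃ f f' : ℝ → ℝ, x = (f : GermAtTop) ∧ y = (f' : GermAtTop) ∧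
    ∀ᶠ t in atTop, HasDerivAt f (f' t) t ∧ ContinuousAt f' t

lemma evPos_coe {f : ℝ → ℝ} : EvPos (f : GermAtTop) ↔ ∀ᶠ t in atTop, 0 < f t := Iff.rfl

lemma coe_eq_zero {f : ℝ → ℝ} : (f : GermAtTop) = 0 ↔ ∀ᶠ t in atTop, f t = 0 := Germ.coe_eq

lemma coe_mul_eq_one {f g : ℝ → ℝ} :
    (f : GermAtTop) * (g : GermAtTop) = 1 ↔ ∀ᶠ t in atTop, f t * g t = 1 := Germ.coe_eq

lemma EvPos.ne_zero {x : GermAtTop} (hx : EvPos x) : x ≠ 0 := by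
  induction x using Germ.inductionOn with | _ f
  intro h
  obtain ⟨t, h1, h2⟩ := ((evPos_coe.1 hx).and (coe_eq_zero.1 h)).exists
  exact h1.ne' h2

lemma EvPos.add {x y : GermAtTop} (hx : EvPos x) (hy : EvPos y) : EvPos (x + y) := by
  induction x using Germ.inductionOn with | _ f
  induction y using Germ.inductionOn with | _ g
  filter_upwards [evPos_coe.1 hx, evPos_coe.1 hy] with t h1 h2 using add_pos h1 h2

lemma EvPos.mul {x y : GermAtTop} (hx : EvPos x) (hy : EvPos y) : EvPos (x * y) := by
  induction x using Germ.inductionOn with | _ f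
  induction y using Germ.inductionOn with | _ g
  filter_upwards [evPos_coe.1 hx, evPos_coe.1 hy] with t h1 h2 using mul_pos h1 h2

lemma EvPos.of_mul_eq_one {x y : GermAtTop} (hx : EvPos x) (h : x * y = 1) : EvPos y := by
  induction x using Germ.inductionOn with | _ f
  induction y using Germ.inductionOn with | _ g
  filter_upwards [evPos_coe.1 hx, coe_mul_eq_one.1 h] with t h1 h2
  exact pos_of_mul_pos_right (h2 ▸ one_pos) h1.le

lemma evPos_constHom {c : ℝ} (hc : 0 < c) : EvPos (constHom c) :=
  evPos_coe.2 (Eventually.of_forall fun _ ↦ hc)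

lemma le_of_evPos_sub {x y : GermAtTop} (h : EvPos (y - x)) : x ≤ y := by
  induction x using Germ.inductionOn with | _ f
  induction y using Germ.inductionOn with | _ g
  refine Germ.coe_le.2 ?_
  filter_upwards [evPos_coe.1 h] with t ht
  exact (sub_pos.1 ht).le

lemma not_le_of_evPos_sub {x y : GermAtTop} (h : EvPos (y - x)) : ¬ y ≤ x := by
  induction x using Germ.inductionOn with | _ f
  induction y using Germ.inductionOn with | _ g
  intro hle
  obtain ⟨t, h1, h2⟩ := ((evPos_coe.1 h).and (Germ.coe_le.1 hle)).exists
  exact (sub_pos.1 h1).not_ge h2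

lemma HasSign.neg {x : GermAtTop} (hx : HasSign x) : HasSign (-x) := by
  rcases hx with rfl | hx | hx
  exacts [.inl neg_zero, .inr (.inr (by rwa [neg_neg])), .inr (.inl hx)]

lemma HasSign.mul {x y : GermAtTop} (hx : HasSign x) (hy : HasSign y) : HasSign (x * y) := by
  rcases hx with rfl | hx | hx
  · exact .inl (zero_mul y)
  · rcases hy with rfl | hy | hy
    · exact .inl (mul_zero x)
    · exact .inr (.inl (hx.mul hy))
    · exact .inr (.inr (by simpa using hx.mul hy))
  · rcases hy with rfl | hy | hy
    · exact .inl (mul_zero x)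
    · exact .inr (.inr (by simpa using hx.mul hy))
    · exact .inr (.inl (by simpa using hx.mul hy))

lemma HasSign.of_mul_eq_one {x y : GermAtTop} (hx : HasSign x) (h : x * y = 1) : HasSign y := by
  rcases hx with rfl | hx | hx
  · rw [zero_mul] at h
    exact .inl (by rw [← one_mul y, ← h, zero_mul])
  · exact .inr (.inl (hx.of_mul_eq_one h))
  · exact .inr (.inr (hx.of_mul_eq_one (by rw [neg_mul_neg, h])))

lemma HasSign.isUnit {x : GermAtTop} (hx : HasSign x) (h0 : x ≠ 0) : IsUnit x := by
  have key : ∀ y, EvPos y → IsUnit y := by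
    intro y hy
    induction y using Germ.inductionOn with | _ f
    refine .of_mul_eq_one ((fun t ↦ (f t)⁻¹ : ℝ → ℝ) : GermAtTop) (coe_mul_eq_one.2 ?_)
    filter_upwards [evPos_coe.1 hy] with t ht using mul_inv_cancel₀ ht.ne'
  rcases hx with hx | hx | hx
  exacts [absurd hx h0, key x hx, by simpa using (key _ hx).neg]

lemma eventually_atTop_eventually_nhds {p : ℝ → Prop} (h : ∀ᶠ t in atTop, p t) :
    ∀ᶠ t in atTop, ∀ᶠ s in nhds t, p s := by
  obtain ⟨a, ha⟩ := eventually_atTop.1 h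
  filter_upwards [eventually_gt_atTop a] with t ht
  filter_upwards [Ioi_mem_nhds ht] with s hs using ha s (le_of_lt hs)

lemma GermDeriv.unique {x y z : GermAtTop} (hy : GermDeriv x y) (hz : GermDeriv x z) : y = z := by
  obtain ⟨f, f', rfl, rfl, hf⟩ := hy
  obtain ⟨g, g', hfg, rfl, hg⟩ := hz
  refine Germ.coe_eq.2 ?_
  filter_upwards [hf, hg, eventually_atTop_eventually_nhds (Germ.coe_eq.1 hfg)] with t h1 h2 h3
  exact h1.1.unique (h2.1.congr_of_eventuallyEq h3)

lemma germDeriv_constHom (c : ℝ) : GermDeriv (constHom c) 0 :=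
  ⟨fun _ ↦ c, fun _ ↦ 0, rfl, rfl, Eventually.of_forall fun t ↦
    ⟨hasDerivAt_const t c, continuousAt_const⟩⟩

lemma GermDeriv.add {x y x' y' : GermAtTop} (hx : GermDeriv x x') (hy : GermDeriv y y') :
    GermDeriv (x + y) (x' + y') := by
  obtain ⟨f, f', rfl, rfl, hf⟩ := hx
  obtain ⟨g, g', rfl, rfl, hg⟩ := hy
  refine ⟨f + g, f' + g', rfl, rfl, ?_⟩
  filter_upwards [hf, hg] with t h1 h2 using ⟨h1.1.add h2.1, h1.2.add h2.2⟩

lemma GermDeriv.neg {x x' : GermAtTop} (hx : GermDeriv x x') : GermDeriv (-x) (-x') := by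
  obtain ⟨f, f', rfl, rfl, hf⟩ := hx
  refine ⟨-f, -f', rfl, rfl, ?_⟩
  filter_upwards [hf] with t h1 using ⟨h1.1.neg, h1.2.neg⟩

lemma GermDeriv.mul {x y x' y' : GermAtTop} (hx : GermDeriv x x') (hy : GermDeriv y y') :
    GermDeriv (x * y) (x' * y + x * y') := by
  obtain ⟨f, f', rfl, rfl, hf⟩ := hx
  obtain ⟨g, g', rfl, rfl, hg⟩ := hy
  refine ⟨f * g, f' * g + f * g', rfl, rfl, ?_⟩
  filter_upwards [hf, hg] with t h1 h2
  exact ⟨h1.1.mul h2.1, (h1.2.mul h2.1.continuousAt).add (h1.1.continuousAt.mul h2.2)⟩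

lemma GermDeriv.of_mul_eq_one {x x' y : GermAtTop} (hx : GermDeriv x x') (h : x * y = 1) :
    GermDeriv y (-(x' * (y * y))) := by
  obtain ⟨f, f', rfl, rfl, hf⟩ := hx
  induction y using Germ.inductionOn with | _ g
  have h1 := coe_mul_eq_one.1 h
  have hg : (g : GermAtTop) = ((fun t ↦ (f t)⁻¹ : ℝ → ℝ) : GermAtTop) := by
    refine Germ.coe_eq.2 ?_
    filter_upwards [h1] with t ht using eq_inv_of_mul_eq_one_right ht
  rw [hg]
  refine ⟨fun t ↦ (f t)⁻¹, fun t ↦ -(f' t * ((f t)⁻¹ * (f t)⁻¹)), rfl, rfl, ?_⟩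
  filter_upwards [hf, h1] with t h2 h3
  have h0 : f t ≠ 0 := left_ne_zero_of_mul_eq_one h3
  have hc := h2.1.continuousAt.inv₀ h0
  refine ⟨?_, (h2.2.mul (hc.mul hc)).neg⟩
  refine (h2.1.inv h0).congr_deriv ?_
  field_simp

lemma germDeriv_deriv {f : ℝ → ℝ} {a : ℝ} (hf : ContDiffOn ℝ 1 f (Set.Ioi a)) :
    GermDeriv (f : GermAtTop) ((deriv f : ℝ → ℝ) : GermAtTop) := by
  refine ⟨f, deriv f, rfl, rfl, ?_⟩
  filter_upwards [eventually_gt_atTop a] with t ht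
  have hn : Set.Ioi a ∈ nhds t := Ioi_mem_nhds ht
  exact ⟨((hf.differentiableOn one_ne_zero).differentiableAt hn).hasDerivAt,
    (hf.continuousOn_deriv_of_isOpen isOpen_Ioi le_rfl).continuousAt hn⟩

lemma GermDeriv.exists_contDiffOn {x y : GermAtTop} (h : GermDeriv x y) :
    ∃ (f : ℝ → ℝ) (a : ℝ), x = (f : GermAtTop) ∧
      ContDiffOn ℝ 1 f (Set.Ioi a) ∧ ((deriv f : ℝ → ℝ) : GermAtTop) = y := by
  obtain ⟨f, f', rfl, rfl, hf⟩ := h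
  obtain ⟨a, ha⟩ := eventually_atTop.1 hf
  have hd : ∀ t ∈ Set.Ioi a, deriv f t = f' t := fun t ht ↦ (ha t (le_of_lt ht)).1.deriv
  refine ⟨f, a, rfl, ?_, Germ.coe_eq.2 ?_⟩
  · rw [show (1 : WithTop ℕ∞) = 0 + 1 from rfl, contDiffOn_succ_iff_deriv_of_isOpen isOpen_Ioi]
    refine ⟨fun t ht ↦ (ha t (le_of_lt ht)).1.differentiableAt.differentiableWithinAt, by simp, ?_⟩
    refine contDiffOn_zero.2 (ContinuousOn.congr (f := f') (fun t ht ↦ ?_) hd)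
    exact (ha t (le_of_lt ht)).2.continuousWithinAt
  · filter_upwards [eventually_gt_atTop a] with t ht using hd t ht

lemma exists_monotoneOn_Ici {f f' : ℝ → ℝ} (hf : ∀ᶠ t in atTop, HasDerivAt f (f' t) t)
    (h0 : ∀ᶠ t in atTop, 0 ≤ f' t) : ∃ a, MonotoneOn f (Set.Ici a) := by
  obtain ⟨a, ha⟩ := eventually_atTop.1 (hf.and h0)
  refine ⟨a, monotoneOn_of_deriv_nonneg (convex_Ici a)
    (fun t ht ↦ (ha t ht).1.continuousAt.continuousWithinAt) (fun t ht ↦ ?_) fun t ht ↦ ?_⟩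
  · exact (ha t (interior_subset ht)).1.differentiableAt.differentiableWithinAt
  · rw [(ha t (interior_subset ht)).1.deriv]
    exact (ha t (interior_subset ht)).2

lemma hasSign_of_monotoneOn {f : ℝ → ℝ} {a : ℝ} (hf : MonotoneOn f (Set.Ici a)) :
    HasSign (f : GermAtTop) := by
  by_cases h1 : ∃ t ≥ a, 0 < f t
  · obtain ⟨t, hta, ht⟩ := h1
    refine .inr (.inl (evPos_coe.2 ?_))
    filter_upwards [eventually_ge_atTop t] with s hs
    exact ht.trans_le (hf hta (hta.trans hs) hs)
  push Not at h1
  by_cases h2 : ∃ t ≥ a, f t = 0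
  · obtain ⟨t, hta, ht⟩ := h2
    refine .inl (coe_eq_zero.2 ?_)
    filter_upwards [eventually_ge_atTop t] with s hs
    exact le_antisymm (h1 s (hta.trans hs)) (ht ▸ hf hta (hta.trans hs) hs)
  push Not at h2
  refine .inr (.inr (evPos_coe (f := -f) |>.2 ?_))
  filter_upwards [eventually_ge_atTop a] with s hs
  exact neg_pos.2 ((h1 s hs).lt_of_ne (h2 s hs))

lemma exists_monotoneOn_of_germDeriv {f : ℝ → ℝ} {y : GermAtTop} (h : GermDeriv f y)
    (hy : y = 0 ∨ EvPos y) : ∃ a, ∃ g : ℝ → ℝ, (f : GermAtTop) = g ∧ MonotoneOn g (Set.Ici a) := by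
  obtain ⟨g, g', hfg, rfl, hg⟩ := h
  obtain ⟨a, ha⟩ := exists_monotoneOn_Ici (hg.mono fun t ht ↦ ht.1) (f' := g') <| by
    rcases hy with hy | hy
    · exact (coe_eq_zero.1 hy).mono fun t ht ↦ ht.ge
    · exact (evPos_coe.1 hy).mono fun t ht ↦ ht.le
  exact ⟨a, g, hfg, ha⟩

lemma GermDeriv.hasSign {x y : GermAtTop} (h : GermDeriv x y) (hy : HasSign y) : HasSign x := by
  have key : ∀ x y, GermDeriv x y → (y = 0 ∨ EvPos y) → HasSign x := by
    intro x y h hy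
    induction x using Germ.inductionOn with | _ f
    obtain ⟨a, g, hfg, hg⟩ := exists_monotoneOn_of_germDeriv h hy
    exact hfg ▸ hasSign_of_monotoneOn hg
  rcases hy with hy | hy | hy
  · exact key x y h (.inl hy)
  · exact key x y h (.inr hy)
  · simpa using (key _ _ h.neg (.inr hy)).neg

lemma GermDeriv.hasSign_of_isUnit {x y : GermAtTop} (h : GermDeriv x y) (hx : IsUnit x) :
    HasSign x := by
  obtain ⟨f, f', rfl, rfl, hf⟩ := h
  obtain ⟨g, hg⟩ := hx.exists_right_inv
  induction g using Germ.inductionOn with | _ g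
  obtain ⟨a, ha⟩ := eventually_atTop.1 (hf.and (coe_mul_eq_one.1 hg))
  have hc : ContinuousOn f (Set.Ici a) :=
    fun t ht ↦ (ha t ht).1.1.continuousAt.continuousWithinAt
  have h0 : ∀ t ∈ Set.Ici a, f t ≠ 0 := fun t ht ↦ left_ne_zero_of_mul_eq_one (ha t ht).2
  have hpre := (isPreconnected_Ici (a := a)).image f hc
  have h0' : (0 : ℝ) ∉ f '' Set.Ici a := by
    rintro ⟨t, ht, h⟩
    exact h0 t ht h
  rcases (h0 a Set.self_mem_Ici).lt_or_gt with h | h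
  · refine .inr (.inr (evPos_coe (f := -f) |>.2 ?_))
    filter_upwards [eventually_ge_atTop a] with t ht
    by_contra! hle
    exact h0' (hpre.ordConnected.out ⟨a, Set.self_mem_Ici, rfl⟩ ⟨t, ht, rfl⟩
      ⟨h.le, by simpa using hle⟩)
  · refine .inr (.inl (evPos_coe.2 ?_))
    filter_upwards [eventually_ge_atTop a] with t ht
    by_contra! hle
    exact h0' (hpre.ordConnected.out ⟨t, ht, rfl⟩ ⟨a, Set.self_mem_Ici, rfl⟩ ⟨hle, h.le⟩)

end Germs

section Adjoin

lemma exists_germDeriv_combSum {H : Subring GermAtTop} (hd : ∀ h ∈ H, ∃ y ∈ H, GermDeriv h y)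
    (s : Multiset (ℝ × GermAtTop)) (hs : ∀ p ∈ s, p.2 ∈ H) :
    ∃ t : Multiset (ℝ × GermAtTop), t.card = s.card ∧ (∀ p ∈ t, p.2 ∈ H) ∧
      GermDeriv (combSum constHom s) (combSum constHom t) := by
  induction s using Multiset.induction with
  | empty => exact ⟨0, rfl, by simp, by simpa [combSum] using germDeriv_constHom 0⟩
  | cons p s ih =>
    obtain ⟨t, hts, htH, ht⟩ := ih fun q hq ↦ hs q (Multiset.mem_cons_of_mem hq)
    obtain ⟨y, hyH, hy⟩ := hd _ (hs p (Multiset.mem_cons_self _ _))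
    refine ⟨(p.1, y) ::ₘ t, by simp [hts], ?_, ?_⟩
    · intro q hq
      rcases Multiset.mem_cons.1 hq with rfl | hq
      exacts [hyH, htH q hq]
    · rw [combSum_cons, combSum_cons]
      simpa using ((germDeriv_constHom p.1).mul hy).add ht

variable {H : Subring GermAtTop}

lemma hasSign_combSum (hinv : ∀ h ∈ H, h ≠ 0 → ∃ g ∈ H, h * g = 1)
    (hd : ∀ h ∈ H, ∃ y ∈ H, GermDeriv h y) (n : ℕ) : ∀ s : Multiset (ℝ × GermAtTop), s.card = n →
    (∀ p ∈ s, p.2 ∈ H) → HasSign (combSum constHom s) := by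
  induction n with
  | zero =>
    intro s hs _
    rw [Multiset.card_eq_zero.1 hs]
    exact .inl (by simp [combSum])
  | succ n ih =>
    intro s hn hs
    obtain ⟨a, s, rfl⟩ := Multiset.card_pos_iff_exists_mem.1 (by omega : 0 < s.card) |>.imp
      fun a ha ↦ Multiset.exists_cons_of_mem ha
    rw [Multiset.card_cons, add_left_inj] at hn
    have haH := hs a (Multiset.mem_cons_self _ _)
    have hsH : ∀ p ∈ s, p.2 ∈ H := fun q hq ↦ hs q (Multiset.mem_cons_of_mem hq)
    rw [combSum_cons]
    rcases eq_or_ne a.2 0 with h0 | h0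
    · rw [h0, mul_zero, zero_add]
      exact ih s hn hsH
    obtain ⟨g, hg, hag⟩ := hinv _ haH h0
    obtain ⟨y, -, hy⟩ := hd _ haH
    have heq : constHom a.1 * a.2 + combSum constHom s =
        a.2 * (constHom a.1 + combSum constHom (s.map fun p ↦ (p.1, g * p.2))) := by
      rw [combSum_map_mul]
      linear_combination (- combSum constHom s) * hag
    rw [heq]
    obtain ⟨t, hts, htH, ht⟩ := exists_germDeriv_combSum hd (s.map fun p ↦ (p.1, g * p.2)) <| by
      simp only [Multiset.mem_map]
      rintro _ ⟨p, hp, rfl⟩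
      exact H.mul_mem hg (hsH p hp)
    refine (hy.hasSign_of_isUnit (.of_mul_eq_one _ hag)).mul
      (((germDeriv_constHom a.1).add ht).hasSign ?_)
    rw [zero_add]
    exact ih t (by rw [hts, Multiset.card_map, hn]) htH

lemma le_adjoinConstants (H : Subring GermAtTop) : H ≤ adjoinConstants H :=
  le_sInf fun _ hS ↦ hS.1

lemma constHom_mem_adjoinConstants (H : Subring GermAtTop) (c : ℝ) :
    constHom c ∈ adjoinConstants H :=
  Subring.mem_sInf.2 fun _ hS ↦ hS.2.1 c

lemma mem_adjoinConstants_of_mul_eq_one {x y : GermAtTop} (hx : x ∈ adjoinConstants H)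
    (h : x * y = 1) : y ∈ adjoinConstants H :=
  Subring.mem_sInf.2 fun S hS ↦ hS.2.2 x (Subring.mem_sInf.1 hx S hS) y h

lemma adjoinConstants_le {S : Subring GermAtTop} (h : H ≤ S) (hc : ∀ c, constHom c ∈ S)
    (hi : ∀ x ∈ S, ∀ y, x * y = 1 → y ∈ S) : adjoinConstants H ≤ S :=
  sInf_le ⟨h, hc, hi⟩

lemma closure_le_adjoinConstants (H : Subring GermAtTop) :
    Subring.closure ((H : Set GermAtTop) ∪ Set.range constHom) ≤ adjoinConstants H :=
  Subring.closure_le.2 <| Set.union_subset (le_adjoinConstants H) <|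
    Set.range_subset_iff.2 (constHom_mem_adjoinConstants H)

/-- The fractions of elements of a subring of a commutative ring. -/
def fractionSubring {A : Type*} [CommRing A] (R : Subring A) : Subring A where
  carrier := {x | ∃ p ∈ R, ∃ q ∈ R, IsUnit q ∧ x * q = p}
  mul_mem' := by
    rintro x y ⟨p, hp, q, hq, hu, h⟩ ⟨p', hp', q', hq', hu', h'⟩
    exact ⟨p * p', R.mul_mem hp hp', q * q', R.mul_mem hq hq', hu.mul hu', by
      rw [← h, ← h']; ring⟩
  one_mem' := ⟨1, R.one_mem, 1, R.one_mem, isUnit_one, one_mul 1⟩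
  add_mem' := by
    rintro x y ⟨p, hp, q, hq, hu, h⟩ ⟨p', hp', q', hq', hu', h'⟩
    exact ⟨p * q' + p' * q, R.add_mem (R.mul_mem hp hq') (R.mul_mem hp' hq), q * q',
      R.mul_mem hq hq', hu.mul hu', by rw [← h, ← h']; ring⟩
  zero_mem' := ⟨0, R.zero_mem, 1, R.one_mem, isUnit_one, zero_mul 1⟩
  neg_mem' := by
    rintro x ⟨p, hp, q, hq, hu, h⟩
    exact ⟨-p, R.neg_mem hp, q, hq, hu, by rw [← h, neg_mul]⟩

lemma exists_mul_eq_of_mem_adjoinConstants {x : GermAtTop} (hx : x ∈ adjoinConstants H) :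
    ∃ p ∈ Subring.closure ((H : Set GermAtTop) ∪ Set.range constHom),
    ∃ q ∈ Subring.closure ((H : Set GermAtTop) ∪ Set.range constHom),
      IsUnit q ∧ x * q = p := by
  have key : ∀ y ∈ (H : Set GermAtTop) ∪ Set.range constHom,
      y ∈ fractionSubring (Subring.closure ((H : Set GermAtTop) ∪ Set.range constHom)) :=
    fun y hy ↦ ⟨y, Subring.subset_closure hy, 1, Subring.one_mem _, isUnit_one, mul_one y⟩
  refine adjoinConstants_le (S := fractionSubring _) (fun h hh ↦ key h (.inl hh))
    (fun c ↦ key _ (.inr ⟨c, rfl⟩)) ?_ hx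
  rintro x ⟨p, hp, q, hq, hu, rfl⟩ y hxy
  exact ⟨q, hq, x * q, hp, (IsUnit.of_mul_eq_one _ hxy).mul hu, by
    linear_combination q * hxy⟩

lemma hasSign_of_mem_adjoinConstants (hinv : ∀ h ∈ H, h ≠ 0 → ∃ g ∈ H, h * g = 1)
    (hd : ∀ h ∈ H, ∃ y ∈ H, GermDeriv h y) {x : GermAtTop} (hx : x ∈ adjoinConstants H) :
    HasSign x := by
  have key : ∀ y ∈ Subring.closure ((H : Set GermAtTop) ∪ Set.range constHom), HasSign y := by
    intro y hy
    obtain ⟨s, hs, rfl⟩ := exists_combSum_of_mem_closure constHom H hy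
    exact hasSign_combSum hinv hd _ s rfl hs
  obtain ⟨p, hp, q, hq, hu, rfl⟩ := exists_mul_eq_of_mem_adjoinConstants hx
  obtain ⟨z, hz⟩ := hu.exists_right_inv
  rw [show x = x * q * z by linear_combination (-x) * hz]
  exact (key _ hp).mul ((key q hq).of_mul_eq_one hz)

lemma exists_germDeriv_of_mem_adjoinConstants (hd : ∀ h ∈ H, ∃ y ∈ H, GermDeriv h y)
    {x : GermAtTop} (hx : x ∈ adjoinConstants H) :
    ∃ y ∈ adjoinConstants H, GermDeriv x y := by
  have key : ∀ y ∈ Subring.closure ((H : Set GermAtTop) ∪ Set.range constHom),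
      ∃ z ∈ adjoinConstants H, GermDeriv y z := by
    intro y hy
    obtain ⟨s, hs, rfl⟩ := exists_combSum_of_mem_closure constHom H hy
    obtain ⟨t, -, htH, ht⟩ := exists_germDeriv_combSum hd s hs
    refine ⟨_, Subring.multiset_sum_mem _ _ fun z hz ↦ ?_, ht⟩
    obtain ⟨p, hp, rfl⟩ := Multiset.mem_map.1 hz
    exact Subring.mul_mem _ (constHom_mem_adjoinConstants H _) (le_adjoinConstants H (htH p hp))
  obtain ⟨p, hp, q, hq, hu, rfl⟩ := exists_mul_eq_of_mem_adjoinConstants hx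
  obtain ⟨z, hz⟩ := hu.exists_right_inv
  have hzK := mem_adjoinConstants_of_mul_eq_one (closure_le_adjoinConstants H hq) hz
  obtain ⟨p', hpK, hp'⟩ := key _ hp
  obtain ⟨q', hqK, hq'⟩ := key _ hq
  have h := hp'.mul (hq'.of_mul_eq_one hz)
  rw [show x * q * z = x by linear_combination x * hz] at h
  refine ⟨_, Subring.add_mem _ (Subring.mul_mem _ hpK hzK) (Subring.mul_mem _
    (closure_le_adjoinConstants H hp) (Subring.neg_mem _ (Subring.mul_mem _ hqK
      (Subring.mul_mem _ hzK hzK)))), h⟩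

lemma isHardyField_adjoinConstants (hinv : ∀ h ∈ H, h ≠ 0 → ∃ g ∈ H, h * g = 1)
    (hd : ∀ h ∈ H, ∃ y ∈ H, GermDeriv h y) : IsHardyField (adjoinConstants H) where
  inv_mem x hx h0 := by
    obtain ⟨y, hy⟩ := ((hasSign_of_mem_adjoinConstants hinv hd hx).isUnit h0).exists_right_inv
    exact ⟨y, mem_adjoinConstants_of_mul_eq_one hx hy, hy⟩
  deriv_mem x hx := by
    obtain ⟨y, hy, h⟩ := exists_germDeriv_of_mem_adjoinConstants hd hx
    obtain ⟨f, a, hf, hfa, rfl⟩ := h.exists_contDiffOn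
    exact ⟨f, a, hf, hfa, hy⟩

end Adjoin

theorem isShort_of_germs {K : Type*} [Field K] [LinearOrder K] [IsStrictOrderedRing K]
    (φ : K →+* GermAtTop) (hφ : ∀ x, 0 < x → EvPos (φ x)) (hd : ∀ x, ∃ y, GermDeriv (φ x) (φ y))
    (C : ℝ →+* K) (hC : ∀ r, φ (C r) = constHom r) {H : Subfield K}
    (hH : ∀ h ∈ H, ∃ y ∈ H, GermDeriv (φ h) (φ y))
    (hK : Subfield.closure ((H : Set K) ∪ Set.range C) = ⊤) (hshort : ShortOn (H : Set K)) :
    IsShort K := by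
  choose d hd using hd
  have hu : ∀ {x y}, GermDeriv (φ x) (φ y) → d x = y := fun h ↦ φ.injective ((hd _).unique h)
  let D₀ : K →+ K :=
    { toFun := d
      map_zero' := hu (by simpa using germDeriv_constHom 0)
      map_add' := fun x y ↦ hu (by simpa using (hd x).add (hd y)) }
  let D : Derivation ℤ K K := Derivation.mk' D₀.toIntLinearMap fun x y ↦ hu (by
    simpa [D₀, mul_comm, add_comm] using (hd x).mul (hd y))
  have hD : ∀ x, D x = d x := fun x ↦ rfl
  have hpos : ∀ x, EvPos (φ x) → 0 < x := by
    intro x hx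
    rcases lt_trichotomy x 0 with h | rfl | h
    · have h1 := hφ (-x) (neg_pos.2 h)
      rw [map_neg] at h1
      exact absurd (add_neg_cancel (φ x)) (hx.add h1).ne_zero
    · exact absurd (map_zero φ) hx.ne_zero
    · exact h
  let C' : ℝ →+*o K :=
    { C with
      monotone' := by
        intro a b hab
        rcases hab.eq_or_lt with rfl | hab
        · exact le_rfl
        · refine (sub_pos.1 (hpos _ ?_)).le
          simpa [hC] using evPos_constHom (sub_pos.2 hab) }
  refine isShort_of_closure_eq_top (D := D) (C := C') ?_ (fun r ↦ hu ?_) (fun h hh ↦ ?_) hK hshort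
  · intro f hf hmk
    by_contra! hle
    have h0 : φ (d f) = 0 ∨ EvPos (φ (d f)) := by
      rcases hle.eq_or_lt with h | h
      · exact .inl (by rw [← hD, ← h, map_zero])
      · exact .inr (hφ _ h)
    have hfd := hd f
    obtain ⟨g, hg⟩ : ∃ g : ℝ → ℝ, φ f = g := (φ f).inductionOn fun g ↦ ⟨g, rfl⟩
    rw [hg] at hfd
    obtain ⟨a, g₁, hgg, hmono⟩ := exists_monotoneOn_of_germDeriv hfd h0
    have hg₁ := hφ f hf
    rw [hg, hgg, evPos_coe] at hg₁
    obtain ⟨t, ht, hta⟩ := (hg₁.and (eventually_ge_atTop a)).exists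
    have hCf : C' (g₁ t) ≤ f := by
      by_contra! hlt
      have h1 := hφ _ (sub_pos.2 hlt)
      have h2 : φ (C' (g₁ t)) = constHom (g₁ t) := hC _
      rw [map_sub, h2, hg, hgg] at h1
      obtain ⟨s, hs, hts⟩ := ((evPos_coe (f := fun s ↦ g₁ t - g₁ s).1 h1).and
        (eventually_ge_atTop t)).exists
      linarith [hmono hta (hta.trans hts) hts]
    have h1 : ArchimedeanClass.mk f ≤ ArchimedeanClass.mk (C' (g₁ t)) := by
      refine ArchimedeanClass.mk_le_mk_of_abs ?_
      rw [abs_of_pos hf, abs_of_nonneg]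
      · exact hCf
      · simpa using C'.monotone' ht.le
    rw [ArchimedeanClass.mk_map_of_archimedean' C' ht.ne'] at h1
    exact h1.not_gt hmk
  · rw [map_zero]
    exact (hC r).symm ▸ germDeriv_constHom r
  · obtain ⟨y, hy, h⟩ := hH h hh
    rw [hD, hu h]
    exact hy

end AsymptoticField

open AsymptoticField

/-- If `H` is a short Hardy field, then `H(ℝ)` is again a Hardy field, is
linearly ordered by the germ ordering, and is short. -/
theorem adjoinConstants_isHardyField_and_short (H : Subring GermAtTop)
    (hH : IsHardyField H) (hshort : IsShort H) :
    IsHardyField (adjoinConstants H) ∧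
    (∀ f g : adjoinConstants H, f ≤ g ∨ g ≤ f) ∧
    IsShort (adjoinConstants H) := by
  have hd : ∀ h ∈ H, ∃ y ∈ H, GermDeriv h y := by
    intro h hh
    obtain ⟨f, a, rfl, hf, hy⟩ := hH.deriv_mem h hh
    exact ⟨_, hy, germDeriv_deriv hf⟩
  have hsign : ∀ x ∈ adjoinConstants H, HasSign x :=
    fun x hx ↦ hasSign_of_mem_adjoinConstants hH.inv_mem hd hx
  have hHardy := isHardyField_adjoinConstants hH.inv_mem hd
  have htotal : ∀ f g : adjoinConstants H, f ≤ g ∨ g ≤ f := by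
    intro f g
    rcases hsign _ (Subring.sub_mem _ g.2 f.2) with h | h | h
    · exact .inl (sub_eq_zero.1 h).ge
    · exact .inl (le_of_evPos_sub h)
    · exact .inr (le_of_evPos_sub (by rwa [neg_sub] at h))
  refine ⟨hHardy, htotal, ?_⟩
  have hfield : IsField (adjoinConstants H) :=
    { exists_pair_ne := ⟨0, 1, fun h ↦ (evPos_constHom one_pos).ne_zero (by
        rw [map_one]; exact (congrArg Subtype.val h).symm)⟩
      mul_comm := mul_comm
      mul_inv_cancel := fun {x} hx ↦ by
        obtain ⟨y, hy, h⟩ := hHardy.inv_mem x x.2 fun h ↦ hx (Subtype.ext h)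
        exact ⟨⟨y, hy⟩, Subtype.ext h⟩ }
  let _ : Field (adjoinConstants H) := hfield.toField
  let _ : LinearOrder (adjoinConstants H) :=
    { (inferInstance : PartialOrder (adjoinConstants H)) with
      le_total := htotal
      toDecidableLE := Classical.decRel _ }
  have : IsOrderedRing (adjoinConstants H) := inferInstance
  have : IsStrictOrderedRing (adjoinConstants H) := IsOrderedRing.toIsStrictOrderedRing _
  let H' : Subfield (adjoinConstants H) :=
    { H.comap (adjoinConstants H).subtype with
      inv_mem' := by
        intro x hx
        rcases eq_or_ne x 0 with rfl | h0
        · rwa [inv_zero]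
        obtain ⟨y, hy, h⟩ := hH.inv_mem x hx fun h ↦ h0 (Subtype.ext h)
        have hxy : x * ⟨y, le_adjoinConstants H hy⟩ = 1 := Subtype.ext h
        rw [inv_eq_of_mul_eq_one_right hxy]
        exact hy }
  let C : ℝ →+* adjoinConstants H :=
    constHom.codRestrict (adjoinConstants H) (constHom_mem_adjoinConstants H)
  refine isShort_of_germs (adjoinConstants H).subtype ?_ ?_ C (fun r ↦ rfl) (H := H') ?_ ?_ ?_
  · intro x hx
    rcases hsign x x.2 with h | h | h
    · exact absurd (Subtype.ext h : x = 0) hx.ne'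
    · exact h
    · exact absurd hx.le (not_le_of_evPos_sub (x := (x : GermAtTop)) (y := 0) (by rwa [zero_sub]))
  · intro x
    obtain ⟨y, hy, h⟩ := exists_germDeriv_of_mem_adjoinConstants hd x.2
    exact ⟨⟨y, hy⟩, h⟩
  · intro x hx
    obtain ⟨y, hy, h⟩ := hd x hx
    exact ⟨⟨y, le_adjoinConstants H hy⟩, hy, h⟩
  · have hcl : adjoinConstants H ≤ (Subfield.closure ((H' : Set (adjoinConstants H)) ∪
        Set.range C)).toSubring.map (adjoinConstants H).subtype := by
      refine adjoinConstants_le (fun h hh ↦ ?_) (fun c ↦ ?_) ?_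
      · exact ⟨⟨h, le_adjoinConstants H hh⟩, Subfield.subset_closure (.inl hh), rfl⟩
      · exact ⟨C c, Subfield.subset_closure (.inr ⟨c, rfl⟩), rfl⟩
      · rintro _ ⟨x, hx, rfl⟩ y hxy
        have hy := mem_adjoinConstants_of_mul_eq_one x.2 hxy
        have h : x * ⟨y, hy⟩ = 1 := Subtype.ext hxy
        exact ⟨x⁻¹, Subfield.inv_mem _ hx, by rw [inv_eq_of_mul_eq_one_right h]; rfl⟩
    refine top_unique fun x _ ↦ ?_
    obtain ⟨y, hy, hyx⟩ := hcl x.2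
    rwa [← Subtype.ext hyx]
  · intro A hA
    have lift : ∀ B ⊆ {h : H | ∃ x ∈ A, (x : GermAtTop) = h}, B.Countable →
        ((fun h : H ↦ (⟨h, le_adjoinConstants H h.2⟩ : adjoinConstants H)) '' B ⊆ A ∧
        ((fun h : H ↦ (⟨h, le_adjoinConstants H h.2⟩ : adjoinConstants H)) '' B).Countable) := by
      refine fun B hBA hB ↦ ⟨?_, hB.image _⟩
      rintro _ ⟨h, hh, rfl⟩
      obtain ⟨x, hx, hxh⟩ := hBA hh
      exact Set.mem_of_eq_of_mem (Subtype.ext hxh.symm) hx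
    obtain ⟨⟨B, hBA, hB, hcof⟩, ⟨B', hBA', hB', hcoi⟩⟩ :=
      hshort {h | ∃ x ∈ A, (x : GermAtTop) = h}
    refine ⟨⟨_, (lift B hBA hB).1, (lift B hBA hB).2, fun x hx ↦ ?_⟩,
      ⟨_, (lift B' hBA' hB').1, (lift B' hBA' hB').2, fun x hx ↦ ?_⟩⟩
    · obtain ⟨y, hy, hxy⟩ := hcof ⟨x, hA hx⟩ ⟨x, hx, rfl⟩
      exact ⟨_, ⟨y, hy, rfl⟩, hxy⟩
    · obtain ⟨y, hy, hxy⟩ := hcoi ⟨x, hA hx⟩ ⟨x, hx, rfl⟩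
      exact ⟨_, ⟨y, hy, rfl⟩, hxy⟩
end
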